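/- arXiv:1710.11245 — 4 statements merged into one kernel-verified Lean document; each statement's English description precedes it below -/
import Mathlib

section
/- For 3≤m≤n, the number of orbits of the dihedral group D_n (acting on binary n-tuples by cyclic rotations and reflections of coordinates) on the set of good n-tuples with exactly m ones equals Σ_{d | gcd(m,n)} (φ(d)/(2n))·binom(n/d, m/d) + (1/2)·( binom(⌊m/2⌋ + ⌊(n-m)/2⌋, ⌊m/2⌋) - binom(⌊n/2⌋, m-1) - binom(⌊n/4⌋, ⌊m/2⌋) - binom(⌊(n+2)/4⌋, m/2) ), where binom(x, m/2)=0 for m odd. -/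
/-- A binary `n`-tuple (a function `ZMod n → Bool`) is *good* if it is not identically
false and every cyclic gap between consecutive `true` positions is strictly less than
`n/2` (equivalently, every maximal cyclic block of zeros is short enough). -/
def GoodFun (n : ℕ) (a : ZMod n → Bool) : Prop :=
  (∃ i, a i = true) ∧
    ∀ i, a i = true → ∃ k : ℕ, 0 < k ∧ 2 * k < n ∧ a (i + (k : ZMod n)) = true

/-- The number of ones of a binary `n`-tuple. -/
noncomputable def onesCount (n : ℕ) (a : ZMod n → Bool) : ℕ :=
  {i : ZMod n | a i = true}.ncard
/-- The dihedral relation on good binary `n`-tuples with exactly `m` ones: two tuples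
are related iff one is obtained from the other by a rotation or a reflection of the
coordinates. -/
def DihedralRelM (n m : ℕ)
    (a b : {a : ZMod n → Bool // GoodFun n a ∧ onesCount n a = m}) : Prop :=
  ∃ (c : ZMod n) (ε : Bool), ∀ i, b.1 i = a.1 (if ε then c - i else c + i)

open Finset in
lemma invol_count {α : Type*} [DecidableEq α] (U : Finset α) (σ : α → α)
    [DecidablePred fun S : Finset α => ∀ x ∈ S, σ x ∈ S]
    (hU : ∀ x ∈ U, σ x ∈ U) (hσ : ∀ x ∈ U, σ (σ x) = x) (v : α → ℕ)
    (hv : ∀ x ∈ U, ∀ y ∈ U, v x = v y → x = y) :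
    ∃ q : ℕ, U.card = (U.filter (fun x => σ x = x)).card + 2 * q ∧
      ∀ m : ℕ, ((U.powersetCard m).filter (fun S => ∀ x ∈ S, σ x ∈ S)).card =
        ∑ j ∈ range ((U.filter (fun x => σ x = x)).card + 1),
          ((U.filter (fun x => σ x = x)).card).choose j *
            (if j ≤ m ∧ Even (m - j) then q.choose ((m - j) / 2) else 0) := by
  set F := U.filter (fun x => σ x = x) with hF
  set Q := U.filter (fun x => v x < v (σ x)) with hQ
  have hinj : Set.InjOn σ (U : Set α) := by
    intro x hx y hy h
    rw [← hσ x hx, ← hσ y hy, h]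
  have key : ∀ X ⊆ F, ∀ Y ⊆ Q, (X ∪ (Y ∪ Y.image σ)).card = X.card + 2 * Y.card := by
    intro X hX Y hY
    have h1 : Disjoint Y (Y.image σ) := by
      rw [Finset.disjoint_left]
      intro a ha hb
      obtain ⟨b, hb', rfl⟩ := Finset.mem_image.1 hb
      have h1 := hY ha
      have h2 := hY hb'
      simp only [hQ, mem_filter] at h1 h2
      rw [hσ b h2.1] at h1
      omega
    have h2 : Disjoint X (Y ∪ Y.image σ) := by
      rw [Finset.disjoint_left]
      intro a ha hb
      have h1 := hX ha
      simp only [hF, mem_filter] at h1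
      rcases Finset.mem_union.1 hb with hb | hb
      · have h2 := hY hb
        simp only [hQ, mem_filter] at h2
        rw [h1.2] at h2
        omega
      · obtain ⟨b, hb', rfl⟩ := Finset.mem_image.1 hb
        have h2 := hY hb'
        simp only [hQ, mem_filter] at h2
        rw [hσ b h2.1] at h1
        rw [← h1.2] at h2
        omega
    rw [card_union_of_disjoint h2, card_union_of_disjoint h1, card_image_of_injOn]
    · ring
    · intro x hx y hy h
      exact hinj (mem_filter.1 (hY hx)).1 (mem_filter.1 (hY hy)).1 h
  have dec : ∀ S ⊆ U, (∀ x ∈ S, σ x ∈ S) → (S ∩ F) ∪ ((S ∩ Q) ∪ (S ∩ Q).image σ) = S := by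
    intro S hS hinv
    ext x
    simp only [mem_union, mem_inter, mem_image, hF, hQ, mem_filter]
    constructor
    · rintro (h | h | ⟨y, h, rfl⟩)
      · exact h.1
      · exact h.1
      · exact hinv _ h.1
    · intro hx
      have hxU := hS hx
      rcases lt_trichotomy (v x) (v (σ x)) with h | h | h
      · exact Or.inr (Or.inl ⟨hx, hxU, h⟩)
      · exact Or.inl ⟨hx, hxU, (hv _ hxU _ (hU _ hxU) h).symm⟩
      · refine Or.inr (Or.inr ⟨σ x, ⟨hinv _ hx, hU _ hxU, ?_⟩, hσ _ hxU⟩)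
        rwa [hσ _ hxU]
  refine ⟨Q.card, ?_, ?_⟩
  · rw [← key F subset_rfl Q subset_rfl]
    conv_lhs => rw [← dec U subset_rfl hU]
    rw [inter_eq_right.2 (filter_subset _ _), inter_eq_right.2 (filter_subset _ _)]
  · intro m
    have step : ((U.powersetCard m).filter (fun S => ∀ x ∈ S, σ x ∈ S)).card =
        ((F.powerset ×ˢ Q.powerset).filter (fun p => p.1.card + 2 * p.2.card = m)).card := by
      refine Finset.card_nbij' (fun S => (S ∩ F, S ∩ Q)) (fun p => p.1 ∪ (p.2 ∪ p.2.image σ)) ?_ ?_ ?_ ?_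
      · intro S hS
        simp only [coe_filter, mem_powersetCard, Set.mem_ofPred_eq, mem_product, mem_powerset] at hS ⊢
        refine ⟨⟨inter_subset_right, inter_subset_right⟩, ?_⟩
        rw [← key _ inter_subset_right _ inter_subset_right, dec S hS.1.1 hS.2, hS.1.2]
      · rintro ⟨X, Y⟩ hp
        simp only [coe_filter, mem_powersetCard, Set.mem_ofPred_eq, mem_product, mem_powerset] at hp ⊢
        obtain ⟨⟨hX, hY⟩, hc⟩ := hp
        refine ⟨⟨?_, ?_⟩, ?_⟩
        · refine union_subset (hX.trans (filter_subset _ _)) (union_subset (hY.trans (filter_subset _ _)) ?_)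
          intro x hx
          obtain ⟨y, hy, rfl⟩ := mem_image.1 hx
          exact hU _ (mem_filter.1 (hY hy)).1
        · rw [key X hX Y hY, hc]
        · intro x hx
          simp only [mem_union, mem_image] at hx ⊢
          rcases hx with h | h | ⟨y, hy, rfl⟩
          · left
            rw [(mem_filter.1 (hX h)).2]; exact h
          · exact Or.inr (Or.inr ⟨x, h, rfl⟩)
          · right; left
            rw [hσ _ (mem_filter.1 (hY hy)).1]; exact hy
      · intro S hS
        simp only [coe_filter, mem_powersetCard, Set.mem_ofPred_eq] at hS
        exact dec S hS.1.1 hS.2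
      · rintro ⟨X, Y⟩ hp
        simp only [coe_filter, Set.mem_ofPred_eq, mem_product, mem_powerset] at hp
        obtain ⟨⟨hX, hY⟩, hc⟩ := hp
        have e1 : ∀ x ∈ F, σ x = x := fun x hx => (mem_filter.1 hx).2
        have e2 : ∀ x ∈ Q, x ∈ U ∧ v x < v (σ x) := fun x hx => mem_filter.1 hx
        simp only [Prod.mk.injEq]
        constructor
        · ext x
          simp only [mem_inter, mem_union, mem_image]
          constructor
          · rintro ⟨h | h | ⟨y, hy, rfl⟩, hxF⟩
            · exact h
            · have := e2 x (hY h); rw [e1 x hxF] at this; omega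
            · have := e2 y (hY hy)
              have h3 := e1 _ hxF
              rw [hσ _ this.1] at h3
              rw [← h3] at this; omega
          · intro h; exact ⟨Or.inl h, hX h⟩
        · ext x
          simp only [mem_inter, mem_union, mem_image]
          constructor
          · rintro ⟨h | h | ⟨y, hy, rfl⟩, hxF⟩
            · have := e2 x hxF; rw [e1 x (hX h)] at this; omega
            · exact h
            · have := e2 y (hY hy)
              have h3 := e2 _ hxF
              rw [hσ _ this.1] at h3
              omega
          · intro h; exact ⟨Or.inr (Or.inl h), hY h⟩
    rw [step, Finset.card_filter, Finset.sum_product]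
    have inner : ∀ X ∈ F.powerset, (∑ Y ∈ Q.powerset, if X.card + 2 * Y.card = m then 1 else 0) =
        (fun j => if j ≤ m ∧ Even (m - j) then Q.card.choose ((m - j) / 2) else 0) X.card := by
      intro X _
      simp only
      rw [← Finset.card_filter]
      split_ifs with h
      · rw [← Finset.card_powersetCard]
        congr 1
        ext Y
        obtain ⟨h1, k, hk⟩ := h
        simp only [mem_filter, mem_powerset, mem_powersetCard]
        refine and_congr_right fun _ => ?_
        omega
      · rw [Finset.card_eq_zero, Finset.filter_eq_empty_iff]
        intro Y _ hc
        apply h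
        refine ⟨by omega, Y.card, by omega⟩
    rw [Finset.sum_congr rfl inner]
    refine (Finset.sum_powerset_apply_card
      (fun j => if j ≤ m ∧ Even (m - j) then Q.card.choose ((m - j) / 2) else 0)).trans ?_
    simp only [smul_eq_mul]

open Finset in
/-- saturated sets -/
lemma satur_count {α β : Type*} [Fintype α] [Fintype β] [DecidableEq α] [DecidableEq β]
    (f : α → β) (d : ℕ) (hd : 0 < d)
    (hf : ∀ b, (univ.filter (fun a => f a = b)).card = d) (m : ℕ) :
    ((powersetCard m (univ : Finset α)).filter
      (fun S => ∀ x y, f x = f y → x ∈ S → y ∈ S)).card =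
      if d ∣ m then (Fintype.card β).choose (m / d) else 0 := by
  have hsurj : Function.Surjective f := by
    intro b
    have : (univ.filter (fun a => f a = b)).Nonempty := by
      rw [← card_pos, hf]; exact hd
    obtain ⟨a, ha⟩ := this
    exact ⟨a, (mem_filter.1 ha).2⟩
  have hc : ∀ T : Finset β, (univ.filter (fun a => f a ∈ T)).card = d * T.card := by
    intro T
    rw [Finset.card_eq_sum_card_fiberwise (f := f) (t := T)]
    · rw [mul_comm, ← smul_eq_mul, ← Finset.sum_const]
      refine sum_congr rfl fun b hb => ?_
      rw [← hf b]
      congr 1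
      ext a
      simp only [mem_filter, mem_univ, true_and]
      constructor
      · exact fun h => h.2
      · rintro rfl; exact ⟨hb, rfl⟩
    · intro a ha
      simpa using ha
  have step : ((powersetCard m (univ : Finset α)).filter
      (fun S => ∀ x y, f x = f y → x ∈ S → y ∈ S)).card =
      ((univ : Finset (Finset β)).filter (fun T => d * T.card = m)).card := by
    symm
    refine Finset.card_bij (fun T _ => univ.filter (fun a => f a ∈ T)) ?_ ?_ ?_
    · intro T hT
      simp only [mem_filter, mem_univ, true_and, mem_powersetCard, subset_univ] at hT ⊢
      refine ⟨by rw [hc, hT], fun x y h hx => h ▸ hx⟩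
    · intro T _ T' _ h
      ext b
      obtain ⟨a, rfl⟩ := hsurj b
      have := congrArg (a ∈ ·) h
      simpa using this
    · intro S hS
      simp only [mem_filter, true_and, mem_powersetCard, subset_univ] at hS
      have e : univ.filter (fun a => f a ∈ S.image f) = S := by
        ext a
        simp only [mem_filter, mem_univ, true_and, mem_image]
        constructor
        · rintro ⟨x, hx, h⟩
          exact hS.2 x a h hx
        · exact fun h => ⟨a, h, rfl⟩
      refine ⟨S.image f, ?_, e⟩
      simp only [mem_filter, mem_univ, true_and]
      rw [← hc, e, hS.1]
  rw [step]
  split_ifs with h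
  · obtain ⟨k, rfl⟩ := h
    rw [Nat.mul_div_cancel_left _ hd, ← Finset.card_univ, ← card_powersetCard]
    congr 1
    ext T
    simp [hd.ne']
  · rw [Finset.card_eq_zero, Finset.filter_eq_empty_iff]
    rintro T _ rfl
    exact h ⟨_, rfl⟩

open Finset in
lemma rot_one (n : ℕ) [NeZero n] (m : ℕ) (c : ZMod n) :
    ((powersetCard m (univ : Finset (ZMod n))).filter (fun S => ∀ x ∈ S, c + x ∈ S)).card =
      if addOrderOf c ∣ m then (n / addOrderOf c).choose (m / addOrderOf c) else 0 := by
  classical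
  let H := AddSubgroup.zmultiples c
  have hd : 0 < addOrderOf c := addOrderOf_pos c
  have hH : Nat.card H = addOrderOf c := Nat.card_zmultiples c
  have hQ : Fintype.card (ZMod n ⧸ H) = n / addOrderOf c := by
    have := H.card_eq_card_quotient_mul_card_addSubgroup
    rw [hH, Nat.card_zmod, Nat.card_eq_fintype_card] at this
    rw [Nat.div_eq_of_eq_mul_left hd this]
  have hf : ∀ b : ZMod n ⧸ H, (univ.filter (fun a => (QuotientAddGroup.mk a : ZMod n ⧸ H) = b)).card = addOrderOf c := by
    intro b
    obtain ⟨b, rfl⟩ := QuotientAddGroup.mk_surjective b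
    rw [← hH, Nat.card_eq_fintype_card, ← Finset.card_univ]
    symm
    refine Finset.card_bij (fun h _ => b + (h : ZMod n)) ?_ ?_ ?_
    · intro h _
      simp only [mem_filter, mem_univ, true_and]
      rw [eq_comm, QuotientAddGroup.eq]
      simp
    · intro h _ h' _ e
      exact Subtype.ext (add_left_cancel e)
    · intro a ha
      simp only [mem_filter, mem_univ, true_and] at ha
      rw [eq_comm, QuotientAddGroup.eq] at ha
      exact ⟨⟨_, ha⟩, mem_univ _, by simp⟩
  have := satur_count (fun a => (QuotientAddGroup.mk a : ZMod n ⧸ H)) _ hd hf m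
  rw [hQ] at this
  rw [← this]
  congr 1
  ext S
  simp only [mem_filter]
  refine and_congr_right fun _ => ?_
  constructor
  · intro h x y hxy hx
    rw [QuotientAddGroup.eq] at hxy
    have hxy' : -x + y ∈ AddSubmonoid.multiples c := by
      rw [mem_multiples_iff_mem_zmultiples]; exact hxy
    obtain ⟨k, hk⟩ := hxy'
    have : ∀ k : ℕ, k • c + x ∈ S := by
      intro k
      induction k with
      | zero => simpa using hx
      | succ k ih =>
        have := h _ ih
        rwa [← add_assoc, ← succ_nsmul'] at this
    have h2 := this k
    simp only at hk
    rw [hk] at h2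
    simpa using h2
  · intro h x hx
    refine h x _ ?_ hx
    rw [QuotientAddGroup.eq]
    have : -x + (c + x) = c := by ring
    rw [this]
    exact AddSubgroup.mem_zmultiples c

open Finset in
lemma rot_sum (n : ℕ) [NeZero n] (m : ℕ) :
    ∑ c : ZMod n, ((powersetCard m (univ : Finset (ZMod n))).filter (fun S => ∀ x ∈ S, c + x ∈ S)).card =
      ∑ d ∈ (Nat.gcd m n).divisors, Nat.totient d * (n / d).choose (m / d) := by
  simp only [rot_one]
  have hn := NeZero.ne n
  rw [← Finset.sum_fiberwise_of_maps_to (s := univ) (t := n.divisors) (g := fun c : ZMod n => addOrderOf c)]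
  · have : (Nat.gcd m n).divisors = n.divisors.filter (fun d => d ∣ m) := by
      ext d
      simp only [Nat.mem_divisors, mem_filter, Nat.dvd_gcd_iff]
      constructor
      · rintro ⟨⟨h1, h2⟩, h3⟩; exact ⟨⟨h2, hn⟩, h1⟩
      · rintro ⟨⟨h1, h2⟩, h3⟩; exact ⟨⟨h3, h1⟩, Nat.gcd_ne_zero_right hn⟩
    rw [this, Finset.sum_filter]
    refine sum_congr rfl fun d hd => ?_
    have hdn := (Nat.mem_divisors.1 hd).1
    have h1 : ∀ c ∈ univ.filter (fun c : ZMod n => addOrderOf c = d),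
        (if addOrderOf c ∣ m then (n / addOrderOf c).choose (m / addOrderOf c) else 0) =
        if d ∣ m then (n / d).choose (m / d) else 0 := by
      intro c hc
      rw [(mem_filter.1 hc).2]
    rw [sum_congr rfl h1, sum_const, IsAddCyclic.card_addOrderOf_eq_totient (by rwa [ZMod.card])]
    split_ifs <;> simp
  · intro c _
    rw [Nat.mem_divisors]
    refine ⟨?_, hn⟩
    have := addOrderOf_dvd_card (x := c)
    rwa [ZMod.card] at this

open Finset in
lemma refl_fix_le (n : ℕ) [NeZero n] (c : ZMod n) :
    (univ.filter (fun x : ZMod n => c - x = x)).card ≤ 2 := by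
  have : (univ.filter (fun x : ZMod n => c - x = x)).card ≤ ({c.val, c.val + n} : Finset ℕ).card := by
    refine card_le_card_of_injOn (fun x => 2 * x.val) ?_ ?_
    · intro x hx
      simp only [coe_filter, mem_univ, true_and, Set.mem_ofPred_eq] at hx
      have hc : c = ((2 * x.val : ℕ) : ZMod n) := by
        push_cast
        rw [ZMod.natCast_zmod_val]
        linear_combination hx
      have h1 : c.val = (2 * x.val) % n := by
        rw [hc, ZMod.val_natCast]
      have h2 := ZMod.val_lt x
      simp only [coe_insert, coe_singleton, Set.mem_insert_iff, Set.mem_singleton_iff]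
      rcases lt_or_ge (2 * x.val) n with h | h
      · rw [Nat.mod_eq_of_lt h] at h1; omega
      · rw [Nat.mod_eq_sub_mod h, Nat.mod_eq_of_lt (by omega)] at h1; omega
    · intro x _ y _ h
      apply ZMod.val_injective n
      simp only at h
      omega
  exact this.trans (card_le_two)

open Finset in
lemma refl_fix_sum (n : ℕ) [NeZero n] :
    ∑ c : ZMod n, (univ.filter (fun x : ZMod n => c - x = x)).card = n := by
  simp only [card_filter]
  rw [sum_comm]
  have : ∀ x : ZMod n, (∑ c : ZMod n, if c - x = x then 1 else 0) = 1 := by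
    intro x
    simp [sub_eq_iff_eq_add]
  simp [this, ZMod.card]

open Finset in
lemma refl_sum (n : ℕ) [NeZero n] (m : ℕ) (hmn : m ≤ n) (hm : 3 ≤ m) :
    ∑ c : ZMod n, ((powersetCard m (univ : Finset (ZMod n))).filter (fun S => ∀ x ∈ S, c - x ∈ S)).card =
      n * (m / 2 + (n - m) / 2).choose (m / 2) := by
  have key : ∀ c : ZMod n, 2 * ((powersetCard m (univ : Finset (ZMod n))).filter (fun S => ∀ x ∈ S, c - x ∈ S)).card =
      if n % 2 = 0 ∧ m % 2 = 1 then (univ.filter (fun x : ZMod n => c - x = x)).card * (2 * (m / 2 + (n - m) / 2).choose (m / 2))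
      else 2 * (m / 2 + (n - m) / 2).choose (m / 2) := by
    intro c
    obtain ⟨q, hq, hS⟩ := invol_count (univ : Finset (ZMod n)) (fun x => c - x) (by simp) (by simp) ZMod.val
      (fun x _ y _ h => ZMod.val_injective n h)
    rw [hS]
    have hle := refl_fix_le n c
    set f := (univ.filter (fun x : ZMod n => c - x = x)).card with hf
    rw [card_univ, ZMod.card] at hq
    clear hS
    clear_value f
    have h3 : f = 0 ∨ f = 1 ∨ f = 2 := by omega
    rcases Nat.even_or_odd' m with ⟨k, rfl | rfl⟩
    · obtain ⟨k, rfl⟩ : ∃ k', k = k' + 1 := ⟨k - 1, by omega⟩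
      rw [if_neg (by omega)]
      rcases h3 with rfl | rfl | rfl
      · have e1 : 2 * (k + 1) / 2 = k + 1 := by omega
        have e2 : k + 1 + (n - 2 * (k + 1)) / 2 = q := by omega
        simp [sum_range_succ, e1, e2]
      · have e1 : 2 * (k + 1) / 2 = k + 1 := by omega
        have e2 : k + 1 + (n - 2 * (k + 1)) / 2 = q := by omega
        have e3 : ¬ Even (2 * (k + 1) - 1) := by rw [Nat.even_iff]; omega
        simp [sum_range_succ, e1, e2, e3]
      · have e1 : 2 * (k + 1) / 2 = k + 1 := by omega
        have e2 : k + 1 + (n - 2 * (k + 1)) / 2 = q + 1 := by omega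
        have e3 : ¬ Even (2 * (k + 1) - 1) := by rw [Nat.even_iff]; omega
        have e4 : Even (2 * (k + 1) - 2) := by rw [Nat.even_iff]; omega
        have e5 : (2 * (k + 1) - 2) / 2 = k := by omega
        have e6 : 2 ≤ 2 * (k + 1) := by omega
        simp [sum_range_succ, e1, e2, e3, e4, e5, e6, Nat.choose_succ_succ]
        ring
    · rcases h3 with rfl | rfl | rfl
      · rw [if_pos (by omega)]
        have e3 : ¬ Even (2 * k + 1) := by rw [Nat.even_iff]; omega
        simp [sum_range_succ, e3]
      · rw [if_neg (by omega)]
        have e1 : (2 * k + 1) / 2 = k := by omega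
        have e2 : k + (n - (2 * k + 1)) / 2 = q := by omega
        have e3 : ¬ Even (2 * k + 1) := by rw [Nat.even_iff]; omega
        simp [sum_range_succ, e1, e2, e3]
      · rw [if_pos (by omega)]
        have e1 : (2 * k + 1) / 2 = k := by omega
        have e2 : k + (n - (2 * k + 1)) / 2 = q := by omega
        have e3 : ¬ Even (2 * k + 1) := by rw [Nat.even_iff]; omega
        have e4 : 1 ≤ 2 * k → ¬ Even (2 * k - 1) := by intro _; rw [Nat.even_iff]; omega
        simp [sum_range_succ, e1, e2, e3]
        exact fun h h2 => absurd h2 (e4 h)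
  have h2 : 2 * ∑ c : ZMod n, ((powersetCard m (univ : Finset (ZMod n))).filter (fun S => ∀ x ∈ S, c - x ∈ S)).card =
      2 * (n * (m / 2 + (n - m) / 2).choose (m / 2)) := by
    rw [mul_sum, sum_congr rfl (fun c _ => key c)]
    split_ifs
    · rw [← sum_mul, refl_fix_sum]; ring
    · rw [sum_const, card_univ, ZMod.card, smul_eq_mul]; ring
  omega

/-- number of symmetric subsets of the open interval -/
def symCount (m L : ℕ) : ℕ :=
  (((Finset.Ioo 0 L).powersetCard m).filter (fun S => ∀ x ∈ S, L - x ∈ S)).card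

open Finset in
lemma symCount_zero (m : ℕ) : symCount (m + 1) 0 = 0 := by
  simp [symCount]

open Finset in
lemma symCount_odd (m k : ℕ) : symCount m (2 * k + 1) = if Even m then k.choose (m / 2) else 0 := by
  unfold symCount
  obtain ⟨q, hq, hS⟩ := invol_count (Finset.Ioo 0 (2 * k + 1)) (fun x => 2 * k + 1 - x)
    (by intro x hx; simp only [mem_Ioo] at *; omega)
    (by intro x hx; simp only [mem_Ioo] at *; omega) id (fun x _ y _ h => h)
  rw [hS]
  have hf : ((Finset.Ioo 0 (2 * k + 1)).filter (fun x => 2 * k + 1 - x = x)).card = 0 := by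
    rw [card_eq_zero, filter_eq_empty_iff]
    intro x hx; simp only [mem_Ioo] at *; omega
  rw [hf] at hq ⊢
  rw [Nat.card_Ioo] at hq
  have : q = k := by omega
  subst this
  simp

open Finset in
lemma symCount_even (m k : ℕ) : symCount m (2 * k + 2) = k.choose (m / 2) := by
  unfold symCount
  obtain ⟨q, hq, hS⟩ := invol_count (Finset.Ioo 0 (2 * k + 2)) (fun x => 2 * k + 2 - x)
    (by intro x hx; simp only [mem_Ioo] at *; omega)
    (by intro x hx; simp only [mem_Ioo] at *; omega) id (fun x _ y _ h => h)
  rw [hS]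
  have hf : ((Finset.Ioo 0 (2 * k + 2)).filter (fun x => 2 * k + 2 - x = x)).card = 1 := by
    rw [card_eq_one]
    refine ⟨k + 1, ?_⟩
    ext x
    simp only [mem_filter, mem_Ioo, mem_singleton]; omega
  rw [hf] at hq ⊢
  rw [Nat.card_Ioo] at hq
  have : q = k := by omega
  subst this
  rcases Nat.even_or_odd' m with ⟨j, rfl | rfl⟩
  · have e3 : 1 ≤ 2 * j → ¬ Even (2 * j - 1) := by intro h; rw [Nat.even_iff]; omega
    simp [sum_range_succ]
    intro h h'
    exact absurd h' (e3 (by omega))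
  · have e3 : ¬ Even (2 * j + 1) := by rw [Nat.even_iff]; omega
    have e1 : (2 * j + 1) / 2 = j := by omega
    simp [sum_range_succ, e3, e1]

open Finset in
lemma symCount_sum (m h : ℕ) (hm : 3 ≤ m) :
    ∑ L ∈ range (h + 1), symCount (m - 2) L =
      (h / 2).choose (m / 2) + if Even m then ((h + 1) / 2).choose (m / 2) else 0 := by
  obtain ⟨m, rfl⟩ : ∃ m', m = m' + 3 := ⟨m - 3, by omega⟩
  have e0 : m + 3 - 2 = m + 1 := rfl
  have e1 : (m + 3) / 2 = (m + 1) / 2 + 1 := by omega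
  have e2 : Even (m + 3) ↔ Even (m + 1) := by rw [Nat.even_iff, Nat.even_iff]; omega
  rw [e0, e1]
  simp only [e2]
  induction h with
  | zero => simp [symCount_zero]
  | succ h ih =>
    rw [sum_range_succ, ih]
    rcases Nat.even_or_odd' h with ⟨k, rfl | rfl⟩
    · rw [symCount_odd]
      have a1 : 2 * k / 2 = k := by omega
      have a2 : (2 * k + 1) / 2 = k := by omega
      have a3 : (2 * k + 1 + 1) / 2 = k + 1 := by omega
      rw [a1, a2, a3]
      split_ifs
      · rw [Nat.choose_succ_succ k]; ring
      · rfl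
    · rw [show 2 * k + 1 + 1 = 2 * k + 2 from rfl, symCount_even]
      have a1 : (2 * k + 2) / 2 = k + 1 := by omega
      have a2 : (2 * k + 1) / 2 = k := by omega
      have a3 : (2 * k + 2 + 1) / 2 = k + 1 := by omega
      rw [a1, a2, a3]
      rw [Nat.choose_succ_succ k]; ring

/-- the gap following `i` in `S` is at least `n/2` -/
def BadAt (n : ℕ) (i : ZMod n) (S : Finset (ZMod n)) : Prop :=
  i ∈ S ∧ ∀ k : ℕ, 0 < k → 2 * k < n → i + (k : ZMod n) ∉ S

lemma sub_cast_inj {n : ℕ} {i : ZMod n} {a b : ℕ} (ha : a < n) (hb : b < n)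
    (h : i - (a : ZMod n) = i - (b : ZMod n)) : a = b := by
  have h1 : (a : ZMod n) = b := by linear_combination -h
  rw [ZMod.natCast_eq_natCast_iff'] at h1
  rwa [Nat.mod_eq_of_lt ha, Nat.mod_eq_of_lt hb] at h1

lemma BadAt.exists_rep {n : ℕ} [NeZero n] {i : ZMod n} {S : Finset (ZMod n)} (h : BadAt n i S)
    {x : ZMod n} (hx : x ∈ S) : ∃ t : ℕ, t ≤ n / 2 ∧ x = i - (t : ZMod n) := by
  have hv : (((i - x).val : ℕ) : ZMod n) = i - x := ZMod.natCast_zmod_val _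
  have hlt := ZMod.val_lt (i - x)
  refine ⟨(i - x).val, ?_, by rw [hv]; ring⟩
  by_contra hcon
  apply h.2 (n - (i - x).val) (by omega) (by omega)
  rw [Nat.cast_sub hlt.le, hv]
  simpa using hx

lemma add_ne_sub {n : ℕ} {i : ZMod n} {k t : ℕ} (hk : 0 < k) (hk2 : 2 * k < n) (ht : t ≤ n / 2) :
    i + (k : ZMod n) ≠ i - (t : ZMod n) := by
  intro h
  have h1 : ((k + t : ℕ) : ZMod n) = 0 := by push_cast; linear_combination h
  rw [ZMod.natCast_eq_zero_iff] at h1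
  have := Nat.le_of_dvd (by omega) h1
  omega

lemma bad_unique {n : ℕ} [NeZero n] {i j : ZMod n} {S : Finset (ZMod n)} (hS : 3 ≤ S.card)
    (hi : BadAt n i S) (hj : BadAt n j S) : i = j := by
  by_contra hne
  obtain ⟨t, ht, htj⟩ := hi.exists_rep hj.1
  obtain ⟨s, hs, hsi⟩ := hj.exists_rep hi.1
  have ht0 : t ≠ 0 := by rintro rfl; simp at htj; exact hne htj.symm
  have h1 : ((s + t : ℕ) : ZMod n) = 0 := by push_cast; linear_combination htj + hsi
  rw [ZMod.natCast_eq_zero_iff] at h1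
  have h2 := Nat.le_of_dvd (by omega) h1
  have hsub : S ⊆ {i, j} := by
    intro x hx
    obtain ⟨u, hu, hux⟩ := hi.exists_rep hx
    simp only [Finset.mem_insert, Finset.mem_singleton]
    by_contra hcon
    push Not at hcon
    have hu0 : u ≠ 0 := by rintro rfl; simp at hux; exact hcon.1 hux
    have hut : u ≠ t := by rintro rfl; exact hcon.2 (hux.trans htj.symm)
    apply hj.2 (t - u) (by omega) (by omega)
    rw [Nat.cast_sub (by omega), htj]
    convert hx using 1
    rw [hux]; ring
  have := Finset.card_le_card hsub
  have := Finset.card_le_two (a := i) (b := j)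
  omega

lemma badAt_image {n : ℕ} (i : ZMod n) (T : Finset ℕ) (h0 : 0 ∈ T) (hT : ∀ t ∈ T, t ≤ n / 2) :
    BadAt n i (T.image (fun t : ℕ => i - (t : ZMod n))) := by
  constructor
  · exact Finset.mem_image.2 ⟨0, h0, by simp⟩
  · intro k hk hk2 h
    obtain ⟨t, ht, e⟩ := Finset.mem_image.1 h
    exact add_ne_sub hk hk2 (hT t ht) e.symm

lemma image_inj {n : ℕ} (i : ZMod n) {T T' : Finset ℕ} (hT : ∀ t ∈ T, t < n) (hT' : ∀ t ∈ T', t < n)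
    (h : T.image (fun t : ℕ => i - (t : ZMod n)) = T'.image (fun t : ℕ => i - (t : ZMod n))) : T = T' := by
  ext t
  constructor
  · intro ht
    have := Finset.mem_image_of_mem (fun t : ℕ => i - (t : ZMod n)) ht
    rw [h] at this
    obtain ⟨s, hs, e⟩ := Finset.mem_image.1 this
    rwa [← sub_cast_inj (hT' s hs) (hT t ht) e]
  · intro ht
    have := Finset.mem_image_of_mem (fun t : ℕ => i - (t : ZMod n)) ht
    rw [← h] at this
    obtain ⟨s, hs, e⟩ := Finset.mem_image.1 this
    rwa [← sub_cast_inj (hT s hs) (hT' t ht) e]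

lemma card_image_sub {n : ℕ} (i : ZMod n) {T : Finset ℕ} (hT : ∀ t ∈ T, t < n) :
    (T.image (fun t : ℕ => i - (t : ZMod n))).card = T.card :=
  Finset.card_image_of_injOn fun a ha b hb h => sub_cast_inj (hT a ha) (hT b hb) h

open Finset in
open Classical in
lemma bad_count (n : ℕ) [NeZero n] (i : ZMod n) (m : ℕ) (hm : 3 ≤ m) (hmn : m ≤ n) :
    ((powersetCard m (univ : Finset (ZMod n))).filter (fun S => BadAt n i S)).card =
      (n / 2).choose (m - 1) := by
  have : (n / 2).choose (m - 1) = ((Icc 1 (n / 2)).powersetCard (m - 1)).card := by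
    rw [card_powersetCard, Nat.card_Icc]; simp
  rw [this]
  symm
  have hlt : ∀ T : Finset ℕ, T ⊆ Icc 1 (n / 2) → ∀ t ∈ insert 0 T, t ≤ n / 2 := by
    intro T hT t ht
    rcases mem_insert.1 ht with rfl | ht
    · omega
    · exact (mem_Icc.1 (hT ht)).2
  have h0 : ∀ T : Finset ℕ, T ⊆ Icc 1 (n / 2) → 0 ∉ T := by
    intro T hT h
    have := mem_Icc.1 (hT h)
    omega
  refine card_bij (fun T _ => (insert 0 T).image (fun t : ℕ => i - (t : ZMod n))) ?_ ?_ ?_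
  · intro T hT
    rw [mem_powersetCard] at hT
    simp only [mem_filter, mem_powersetCard, subset_univ, true_and]
    constructor
    · rw [card_image_sub i (fun t ht => by have := hlt T hT.1 t ht; omega),
        card_insert_of_notMem (h0 T hT.1), hT.2]
      omega
    · exact badAt_image i _ (mem_insert_self _ _) (hlt T hT.1)
  · intro T hT T' hT' h
    rw [mem_powersetCard] at hT hT'
    have := image_inj i (fun t ht => by have := hlt T hT.1 t ht; omega)
      (fun t ht => by have := hlt T' hT'.1 t ht; omega) h
    rw [← erase_insert (h0 T hT.1), this, erase_insert (h0 T' hT'.1)]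
  · intro S hS
    simp only [mem_filter, mem_powersetCard, subset_univ, true_and] at hS
    obtain ⟨hc, hb⟩ := hS
    set T := (Icc 1 (n / 2)).filter (fun t : ℕ => i - (t : ZMod n) ∈ S) with hT
    have hTs : T ⊆ Icc 1 (n / 2) := filter_subset _ _
    have e : (insert 0 T).image (fun t : ℕ => i - (t : ZMod n)) = S := by
      ext x
      simp only [mem_image]
      constructor
      · rintro ⟨t, ht, rfl⟩
        rcases mem_insert.1 ht with rfl | ht
        · simpa using hb.1
        · exact (mem_filter.1 ht).2
      · intro hx
        obtain ⟨t, ht, rfl⟩ := hb.exists_rep hx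
        refine ⟨t, ?_, rfl⟩
        rw [mem_insert, hT, mem_filter, mem_Icc]
        rcases Nat.eq_zero_or_pos t with h | h
        · exact Or.inl h
        · exact Or.inr ⟨⟨h, ht⟩, hx⟩
    refine ⟨T, ?_, e⟩
    rw [mem_powersetCard]
    refine ⟨hTs, ?_⟩
    have := card_image_sub i (T := insert 0 T) (fun t ht => by have := hlt T hTs t ht; omega)
    rw [e, card_insert_of_notMem (h0 T hTs)] at this
    omega

open Finset in
open Classical in
lemma bad_refl_count (n : ℕ) [NeZero n] (i : ZMod n) (m : ℕ) (hm : 3 ≤ m) (hmn : m ≤ n) :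
    ∑ c : ZMod n, ((powersetCard m (univ : Finset (ZMod n))).filter
      (fun S => BadAt n i S ∧ ∀ x ∈ S, c - x ∈ S)).card =
      ∑ L ∈ range (n / 2 + 1), symCount (m - 2) L := by
  unfold symCount
  rw [← card_sigma, ← card_sigma]
  symm
  have hL0 : ∀ L : ℕ, ∀ T : Finset ℕ, T ⊆ Ioo 0 L → T.card = m - 2 → 0 < L := by
    intro L T hT hc
    rcases Nat.eq_zero_or_pos L with h | h
    · subst h
      have := card_le_card hT
      simp at this
      subst this
      simp at hc
      omega
    · exact h
  have hle : ∀ L ≤ n / 2, ∀ T : Finset ℕ, T ⊆ Ioo 0 L → ∀ t ∈ insert 0 (insert L T), t ≤ L := by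
    intro L hL T hT t ht
    rcases mem_insert.1 ht with rfl | ht
    · omega
    · rcases mem_insert.1 ht with rfl | ht
      · omega
      · exact (mem_Ioo.1 (hT ht)).2.le
  have hn1 : ∀ L : ℕ, ∀ T : Finset ℕ, T ⊆ Ioo 0 L → L ∉ T := by
    intro L T hT h
    have := mem_Ioo.1 (hT h)
    omega
  have hn0 : ∀ L : ℕ, 0 < L → ∀ T : Finset ℕ, T ⊆ Ioo 0 L → 0 ∉ insert L T := by
    intro L hL T hT h
    rcases mem_insert.1 h with h | h
    · omega
    · have := mem_Ioo.1 (hT h)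
      omega
  refine card_bij (fun p _ => ⟨i + i - (p.1 : ZMod n),
    (insert 0 (insert p.1 p.2)).image (fun t : ℕ => i - (t : ZMod n))⟩) ?_ ?_ ?_
  · rintro ⟨L, T⟩ hT
    simp only [mem_sigma, mem_range, mem_filter, mem_powersetCard, mem_univ, subset_univ, true_and] at hT ⊢
    obtain ⟨hL, ⟨hT, hc⟩, hsym⟩ := hT
    have hLpos := hL0 L T hT hc
    have hle' := hle L (by omega) T hT
    refine ⟨?_, badAt_image i _ (mem_insert_self _ _) (fun t ht => (hle' t ht).trans (by omega)), ?_⟩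
    · rw [card_image_sub i (fun t ht => (hle' t ht).trans_lt (by omega)),
        card_insert_of_notMem (hn0 L hLpos T hT), card_insert_of_notMem (hn1 L T hT), hc]
      omega
    · intro x hx
      obtain ⟨t, ht, rfl⟩ := mem_image.1 hx
      refine mem_image.2 ⟨L - t, ?_, ?_⟩
      · simp only [mem_insert] at ht ⊢
        rcases ht with rfl | rfl | ht
        · right; left; rfl
        · left; omega
        · right; right; exact hsym t ht
      · rw [Nat.cast_sub (hle' t ht)]; ring
  · rintro ⟨L, T⟩ hT ⟨L', T'⟩ hT' h
    simp only [mem_sigma, mem_range, mem_filter, mem_powersetCard] at hT hT'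
    obtain ⟨hL, ⟨hT, hc⟩, hsym⟩ := hT
    obtain ⟨hL', ⟨hT', hc'⟩, hsym'⟩ := hT'
    simp only [Sigma.mk.injEq, heq_eq_eq] at h
    have hLL : L = L' := sub_cast_inj (by omega) (by omega) h.1
    subst hLL
    have hLpos := hL0 L T hT hc
    have := image_inj i (fun t ht => (hle L (by omega) T hT t ht).trans_lt (by omega))
      (fun t ht => (hle L (by omega) T' hT' t ht).trans_lt (by omega)) h.2
    have h2 : insert L T = insert L T' := by
      rw [← erase_insert (hn0 L hLpos T hT), this, erase_insert (hn0 L hLpos T' hT')]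
    have h3 : T = T' := by
      rw [← erase_insert (hn1 L T hT), h2, erase_insert (hn1 L T' hT')]
    rw [h3]
  · rintro ⟨c, S⟩ hS
    simp only [mem_sigma, mem_filter, mem_powersetCard, mem_univ, subset_univ, true_and] at hS
    obtain ⟨hc, hb, hinv⟩ := hS
    obtain ⟨L, hL, hcL⟩ := hb.exists_rep (hinv i hb.1)
    have hcL' : c = i + i - (L : ZMod n) := by linear_combination hcL
    -- every element is within `L`
    have hLpos : 0 < L := by
      by_contra hcon
      obtain rfl : L = 0 := by omega
      simp only [Nat.cast_zero, sub_zero] at hcL'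
      have hsub : S ⊆ {i, i - ((n / 2 : ℕ) : ZMod n)} := by
        intro x hx
        obtain ⟨u, hu, hux⟩ := hb.exists_rep hx
        simp only [mem_insert, mem_singleton]
        by_contra hcon
        push Not at hcon
        have hu0 : u ≠ 0 := by rintro rfl; simp at hux; exact hcon.1 hux
        have hut : u ≠ n / 2 := by rintro rfl; exact hcon.2 hux
        apply hb.2 u (by omega) (by omega)
        convert hinv x hx using 1
        rw [hux, hcL']; ring
      have := card_le_card hsub
      have := card_le_two (a := i) (b := i - ((n / 2 : ℕ) : ZMod n))
      omega
    have hrep : ∀ x ∈ S, ∃ t : ℕ, t ≤ L ∧ x = i - (t : ZMod n) := by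
      intro x hx
      obtain ⟨u, hu, hux⟩ := hb.exists_rep hx
      refine ⟨u, ?_, hux⟩
      by_contra hcon
      apply hb.2 (u - L) (by omega) (by omega)
      convert hinv x hx using 1
      rw [hux, hcL', Nat.cast_sub (by omega)]; ring
    set T := (Ioo 0 L).filter (fun t : ℕ => i - (t : ZMod n) ∈ S) with hT
    have hTs : T ⊆ Ioo 0 L := filter_subset _ _
    have e : (insert 0 (insert L T)).image (fun t : ℕ => i - (t : ZMod n)) = S := by
      ext x
      simp only [mem_image]
      constructor
      · rintro ⟨t, ht, rfl⟩
        rcases mem_insert.1 ht with rfl | ht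
        · simpa using hb.1
        · rcases mem_insert.1 ht with rfl | ht
          · rw [← hcL]; exact hinv i hb.1
          · exact (mem_filter.1 ht).2
      · intro hx
        obtain ⟨t, ht, rfl⟩ := hrep x hx
        refine ⟨t, ?_, rfl⟩
        rw [mem_insert, mem_insert, hT, mem_filter, mem_Ioo]
        rcases Nat.eq_zero_or_pos t with h | h
        · exact Or.inl h
        · rcases ht.eq_or_lt with h' | h'
          · exact Or.inr (Or.inl h')
          · exact Or.inr (Or.inr ⟨⟨h, h'⟩, hx⟩)
    refine ⟨⟨L, T⟩, ?_, ?_⟩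
    · simp only [mem_sigma, mem_range, mem_filter, mem_powersetCard]
      refine ⟨by omega, ⟨hTs, ?_⟩, ?_⟩
      · have := card_image_sub i (T := insert 0 (insert L T))
          (fun t ht => (hle L hL T hTs t ht).trans_lt (by omega))
        rw [e, card_insert_of_notMem (hn0 L hLpos T hTs), card_insert_of_notMem (hn1 L T hTs)] at this
        omega
      · intro t ht
        rw [hT, mem_filter, mem_Ioo] at ht ⊢
        refine ⟨by omega, ?_⟩
        rw [Nat.cast_sub (by omega)]
        convert hinv _ ht.2 using 1
        rw [hcL']; ring
    · simp only [e, hcL']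

lemma goodFun_back {n : ℕ} [NeZero n] {a : ZMod n → Bool} (h : GoodFun n a) {i : ZMod n}
    (hi : a i = true) : ∃ k : ℕ, 0 < k ∧ 2 * k < n ∧ a (i - (k : ZMod n)) = true := by
  by_contra hcon
  push Not at hcon
  have hn : 0 < n := NeZero.pos n
  have hne : ((Finset.range n).filter (fun g : ℕ => a (i + (g : ZMod n)) = true)).Nonempty :=
    ⟨0, by simp [hi, hn]⟩
  obtain ⟨g, hg, hmax⟩ := Finset.exists_max_image _ id hne
  simp only [Finset.mem_filter, Finset.mem_range, id] at hg hmax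
  have hg2 : 2 * g ≤ n := by
    by_contra hlt
    apply hcon (n - g) (by omega) (by omega)
    rw [Nat.cast_sub hg.1.le]
    simpa using hg.2
  obtain ⟨k, hk0, hk2, hk⟩ := h.2 _ hg.2
  have := hmax (g + k) ⟨by omega, by push_cast; rwa [← add_assoc]⟩
  omega

/-- the action of the dihedral group on positions -/
def dact {n : ℕ} : DihedralGroup n → ZMod n → ZMod n
  | .r c, x => c + x
  | .sr c, x => -c - x

lemma dact_one {n : ℕ} (x : ZMod n) : dact (1 : DihedralGroup n) x = x := by
  rw [DihedralGroup.one_def]; simp [dact]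

lemma dact_mul {n : ℕ} (g h : DihedralGroup n) (x : ZMod n) : dact (g * h) x = dact g (dact h x) := by
  rcases g with c | c <;> rcases h with d | d <;> simp [dact] <;> ring

lemma dact_inv_left {n : ℕ} (g : DihedralGroup n) (x : ZMod n) : dact g⁻¹ (dact g x) = x := by
  rw [← dact_mul, inv_mul_cancel, dact_one]

lemma dact_inv_right {n : ℕ} (g : DihedralGroup n) (x : ZMod n) : dact g (dact g⁻¹ x) = x := by
  rw [← dact_mul, mul_inv_cancel, dact_one]

lemma dact_inj {n : ℕ} (g : DihedralGroup n) : Function.Injective (dact g) :=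
  Function.LeftInverse.injective (dact_inv_left g)

lemma goodFun_dact {n : ℕ} [NeZero n] {a : ZMod n → Bool} (h : GoodFun n a) (g : DihedralGroup n) :
    GoodFun n (fun i => a (dact g i)) := by
  constructor
  · obtain ⟨i, hi⟩ := h.1
    exact ⟨dact g⁻¹ i, by simpa only [dact_inv_right] using hi⟩
  · intro i hi
    rcases g with c | c
    · obtain ⟨k, h1, h2, h3⟩ := h.2 _ hi
      refine ⟨k, h1, h2, ?_⟩
      simp only [dact] at h3 ⊢
      rwa [← add_assoc]
    · obtain ⟨k, h1, h2, h3⟩ := goodFun_back h hi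
      refine ⟨k, h1, h2, ?_⟩
      simp only [dact] at h3 ⊢
      rwa [← sub_sub]

lemma onesCount_dact {n : ℕ} (a : ZMod n → Bool) (g : DihedralGroup n) :
    onesCount n (fun i => a (dact g i)) = onesCount n a := by
  unfold onesCount
  exact Set.ncard_preimage_of_injective_subset_range (f := dact g) (dact_inj g)
    (s := {i : ZMod n | a i = true}) (fun i _ => ⟨dact g⁻¹ i, dact_inv_right g i⟩)

/-- the action on good tuples -/
@[reducible] def dihAction (n m : ℕ) [NeZero n] :
    MulAction (DihedralGroup n) {a : ZMod n → Bool // GoodFun n a ∧ onesCount n a = m} where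
  smul g a := ⟨fun i => a.1 (dact g⁻¹ i), goodFun_dact a.2.1 _, by rw [onesCount_dact]; exact a.2.2⟩
  one_smul a := by
    apply Subtype.ext
    funext i
    change a.1 (dact (1 : DihedralGroup n)⁻¹ i) = a.1 i
    rw [inv_one, dact_one]
  mul_smul g h a := by
    apply Subtype.ext
    funext i
    change a.1 (dact (g * h)⁻¹ i) = a.1 (dact h⁻¹ (dact g⁻¹ i))
    rw [mul_inv_rev, dact_mul]

lemma goodFun_iff {n : ℕ} [NeZero n] (a : ZMod n → Bool) :
    GoodFun n a ↔ (∃ i, a i = true) ∧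
      ¬ ∃ i, BadAt n i (Finset.univ.filter (fun i => a i = true)) := by
  unfold GoodFun BadAt
  refine and_congr_right fun _ => ?_
  simp only [Finset.mem_filter, Finset.mem_univ, true_and]
  push Not
  rfl

lemma onesCount_eq {n : ℕ} [NeZero n] (a : ZMod n → Bool) :
    onesCount n a = (Finset.univ.filter (fun i => a i = true)).card := by
  unfold onesCount
  rw [← Set.ncard_coe_finset]
  simp

lemma inv_iff {n : ℕ} {S : Finset (ZMod n)} {f : ZMod n → ZMod n} (hf : Function.Injective f)
    (h : ∀ x ∈ S, f x ∈ S) (x : ZMod n) : f x ∈ S ↔ x ∈ S := by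
  classical
  refine ⟨fun hx => ?_, h x⟩
  have e : S.image f = S := by
    apply Finset.eq_of_subset_of_card_le
    · intro y hy
      obtain ⟨z, hz, rfl⟩ := Finset.mem_image.1 hy
      exact h z hz
    · rw [Finset.card_image_of_injective _ hf]
  rw [← e] at hx
  obtain ⟨z, hz, hzx⟩ := Finset.mem_image.1 hx
  rwa [← hf hzx]

open Finset in
open Classical in
lemma card_fixed (n m : ℕ) [NeZero n] (hm : 3 ≤ m) (g : DihedralGroup n)
    [Fintype (@MulAction.fixedBy _ {a : ZMod n → Bool // GoodFun n a ∧ onesCount n a = m} _ (dihAction n m) g)] :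
    Fintype.card (@MulAction.fixedBy _ {a : ZMod n → Bool // GoodFun n a ∧ onesCount n a = m} _ (dihAction n m) g)
     = ((powersetCard m (univ : Finset (ZMod n))).filter
        (fun S => (¬ ∃ i, BadAt n i S) ∧ ∀ x ∈ S, dact g x ∈ S)).card := by
  rw [← Finset.card_univ]
  refine card_bij (fun p _ => univ.filter (fun i => p.1.1 i = true)) ?_ ?_ ?_
  · rintro ⟨⟨a, ha, hc⟩, hp⟩ _
    simp only [mem_filter, mem_powersetCard, subset_univ, true_and, mem_univ]
    rw [onesCount_eq] at hc
    rw [goodFun_iff] at ha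
    refine ⟨hc, ha.2, ?_⟩
    intro x hx
    have h1 : (fun i => a (dact g⁻¹ i)) = a := congrArg Subtype.val hp
    have h2 := congrFun h1 (dact g x)
    simp only [dact_inv_left] at h2
    rw [← h2, hx]
  · rintro ⟨⟨a, ha, hc⟩, hp⟩ _ ⟨⟨b, hb, hd⟩, hq⟩ _ h
    apply Subtype.ext
    apply Subtype.ext
    funext i
    have := congrArg (i ∈ ·) h
    simp only [mem_filter, mem_univ, true_and, eq_iff_iff] at this
    exact Bool.eq_iff_iff.2 this
  · intro S hS
    simp only [mem_filter, mem_powersetCard, subset_univ, true_and] at hS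
    obtain ⟨hc, hb, hinv⟩ := hS
    have e : univ.filter (fun i => decide (i ∈ S) = true) = S := by
      ext i; simp
    refine ⟨⟨⟨fun i => decide (i ∈ S), ?_, ?_⟩, ?_⟩, mem_univ _, e⟩
    · rw [goodFun_iff, e]
      refine ⟨?_, hb⟩
      have : S.Nonempty := by rw [← card_pos]; omega
      obtain ⟨i, hi⟩ := this
      exact ⟨i, by simpa using hi⟩
    · rw [onesCount_eq, e, hc]
    · apply Subtype.ext
      funext i
      change decide (dact g⁻¹ i ∈ S) = decide (i ∈ S)
      have := inv_iff (dact_inj g) hinv (dact g⁻¹ i)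
      rw [dact_inv_right] at this
      simp only [this]

/-- elements of the dihedral group -/
def dihEquiv (n : ℕ) : ZMod n ⊕ ZMod n ≃ DihedralGroup n where
  toFun
    | .inl c => .r c
    | .inr c => .sr (-c)
  invFun
    | .r c => .inl c
    | .sr c => .inr (-c)
  left_inv := by rintro (c | c) <;> simp
  right_inv := by rintro (c | c) <;> simp

lemma rel_eq (n m : ℕ) [NeZero n] :
    DihedralRelM n m = (@MulAction.orbitRel (DihedralGroup n)
      {a : ZMod n → Bool // GoodFun n a ∧ onesCount n a = m} _ (dihAction n m)).r := by
  letI := dihAction n m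
  funext a b
  apply propext
  constructor
  · rintro ⟨c, ε, h⟩
    rcases ε with _ | _
    · refine ⟨DihedralGroup.r c, ?_⟩
      apply Subtype.ext
      funext i
      change b.1 (dact (DihedralGroup.r c)⁻¹ i) = a.1 i
      rw [h]
      change a.1 (dact (DihedralGroup.r c) _) = a.1 i
      rw [dact_inv_right]
    · refine ⟨DihedralGroup.sr (-c), ?_⟩
      apply Subtype.ext
      funext i
      change b.1 (dact (DihedralGroup.sr (-c))⁻¹ i) = a.1 i
      rw [h]
      have : ∀ x, c - x = dact (DihedralGroup.sr (-c)) x := fun x => by simp [dact]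
      simp only [if_true, this]
      rw [dact_inv_right]
  · rintro ⟨g, hg⟩
    have h1 : ∀ i, b.1 i = a.1 (dact g i) := by
      intro i
      rw [← hg]
      change b.1 i = b.1 (dact g⁻¹ (dact g i))
      rw [dact_inv_left]
    rcases g with c | c
    · exact ⟨c, false, h1⟩
    · exact ⟨-c, true, h1⟩

open Finset in
open Classical in
lemma burnside (n m : ℕ) [NeZero n] (hm : 3 ≤ m) :
    Nat.card (Quot (DihedralRelM n m)) * (2 * n) =
      ∑ c : ZMod n, ((powersetCard m (univ : Finset (ZMod n))).filter
        (fun S => (¬ ∃ i, BadAt n i S) ∧ ∀ x ∈ S, c + x ∈ S)).card +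
      ∑ c : ZMod n, ((powersetCard m (univ : Finset (ZMod n))).filter
        (fun S => (¬ ∃ i, BadAt n i S) ∧ ∀ x ∈ S, c - x ∈ S)).card := by
  letI := dihAction n m
  haveI : Fintype {a : ZMod n → Bool // GoodFun n a ∧ onesCount n a = m} := Fintype.ofFinite _
  have B := MulAction.sum_card_fixedBy_eq_card_orbits_mul_card_group (DihedralGroup n)
    {a : ZMod n → Bool // GoodFun n a ∧ onesCount n a = m}
  rw [rel_eq]
  rw [← Nat.card_eq_fintype_card, DihedralGroup.card] at B
  refine B.symm.trans ?_
  rw [sum_congr rfl (fun g _ => card_fixed n m hm g)]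
  rw [← Equiv.sum_comp (dihEquiv n), Fintype.sum_sum_type]
  congr 1
  refine sum_congr rfl fun c _ => ?_
  simp [dihEquiv, dact]

open Finset in
open Classical in
lemma bad_split (n m : ℕ) [NeZero n] (hm : 3 ≤ m) (P : Finset (ZMod n) → Prop) :
    ((powersetCard m (univ : Finset (ZMod n))).filter
      (fun S => (¬ ∃ i, BadAt n i S) ∧ P S)).card +
      ∑ i : ZMod n, ((powersetCard m (univ : Finset (ZMod n))).filter
      (fun S => BadAt n i S ∧ P S)).card =
    ((powersetCard m (univ : Finset (ZMod n))).filter P).card := by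
  rw [← card_biUnion, ← card_union_of_disjoint]
  · congr 1
    ext S
    simp only [mem_union, mem_filter, mem_biUnion, mem_univ, true_and]
    by_cases h : ∃ i, BadAt n i S
    · obtain ⟨i, hi⟩ := h
      constructor
      · rintro (h | ⟨j, h⟩)
        · exact ⟨h.1, h.2.2⟩
        · exact ⟨h.1, h.2.2⟩
      · rintro ⟨h1, h2⟩
        exact Or.inr ⟨i, h1, hi, h2⟩
    · constructor
      · rintro (h | ⟨j, h⟩)
        · exact ⟨h.1, h.2.2⟩
        · exact ⟨h.1, h.2.2⟩
      · rintro ⟨h1, h2⟩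
        exact Or.inl ⟨h1, h, h2⟩
  · rw [Finset.disjoint_left]
    intro S h1 h2
    simp only [mem_filter, mem_biUnion, mem_univ, true_and] at h1 h2
    obtain ⟨i, h2⟩ := h2
    exact h1.2.1 ⟨i, h2.2.1⟩
  · intro i _ j _ hij
    rw [Function.onFun, Finset.disjoint_left]
    intro S h1 h2
    simp only [mem_filter, mem_powersetCard] at h1 h2
    exact hij (bad_unique (by omega) h1.2.1 h2.2.1)

open Finset in
open Classical in
lemma bad_rot_sum (n m : ℕ) [NeZero n] (hm : 3 ≤ m) (hmn : m ≤ n) :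
    ∑ c : ZMod n, ∑ i : ZMod n, ((powersetCard m (univ : Finset (ZMod n))).filter
      (fun S => BadAt n i S ∧ ∀ x ∈ S, c + x ∈ S)).card = n * (n / 2).choose (m - 1) := by
  rw [Finset.sum_eq_single (0 : ZMod n)]
  · have : ∀ i : ZMod n, ((powersetCard m (univ : Finset (ZMod n))).filter
      (fun S => BadAt n i S ∧ ∀ x ∈ S, 0 + x ∈ S)).card = (n / 2).choose (m - 1) := by
      intro i
      rw [← bad_count n i m hm hmn]
      congr 1
      ext S
      simp
    simp only [this, sum_const, card_univ, ZMod.card, smul_eq_mul]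
  · intro c _ hc
    refine sum_eq_zero fun i _ => ?_
    rw [card_eq_zero, filter_eq_empty_iff]
    rintro S hS ⟨hb, hinv⟩
    rw [mem_powersetCard] at hS
    have hi := inv_iff (add_right_injective c) hinv
    have : BadAt n (c + i) S := by
      refine ⟨hinv i hb.1, fun k h1 h2 h3 => hb.2 k h1 h2 ?_⟩
      rw [add_assoc] at h3
      exact (hi _).1 h3
    have := bad_unique (by omega) hb this
    apply hc
    simpa using this.symm
  · simp

open Finset in
open Classical in
lemma good_rot_sum (n m : ℕ) [NeZero n] (hm : 3 ≤ m) (hmn : m ≤ n) :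
    ∑ c : ZMod n, ((powersetCard m (univ : Finset (ZMod n))).filter
        (fun S => (¬ ∃ i, BadAt n i S) ∧ ∀ x ∈ S, c + x ∈ S)).card + n * (n / 2).choose (m - 1) =
      ∑ d ∈ (Nat.gcd m n).divisors, Nat.totient d * (n / d).choose (m / d) := by
  rw [← rot_sum n m, ← bad_rot_sum n m hm hmn, ← sum_add_distrib]
  refine sum_congr rfl fun c _ => ?_
  convert bad_split n m hm (fun S => ∀ x ∈ S, c + x ∈ S)

open Finset in
open Classical in
lemma good_refl_sum (n m : ℕ) [NeZero n] (hm : 3 ≤ m) (hmn : m ≤ n) :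
    ∑ c : ZMod n, ((powersetCard m (univ : Finset (ZMod n))).filter
        (fun S => (¬ ∃ i, BadAt n i S) ∧ ∀ x ∈ S, c - x ∈ S)).card +
      n * ((n / 2 / 2).choose (m / 2) + if Even m then ((n / 2 + 1) / 2).choose (m / 2) else 0) =
      n * (m / 2 + (n - m) / 2).choose (m / 2) := by
  have h : n * ∑ L ∈ range (n / 2 + 1), symCount (m - 2) L =
      ∑ i : ZMod n, ∑ c : ZMod n, ((powersetCard m (univ : Finset (ZMod n))).filter
        (fun S => BadAt n i S ∧ ∀ x ∈ S, c - x ∈ S)).card := by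
    rw [sum_congr rfl (fun i _ => bad_refl_count n i m hm hmn), sum_const, card_univ, ZMod.card,
      smul_eq_mul]
  have h' := symCount_sum m (n / 2) hm
  rw [← refl_sum n m hmn hm]
  have e : ((n / 2 / 2).choose (m / 2) + if Even m then ((n / 2 + 1) / 2).choose (m / 2) else 0) =
      ∑ L ∈ range (n / 2 + 1), symCount (m - 2) L := by
    rw [h']
  rw [e, h, sum_comm, ← sum_add_distrib]
  refine sum_congr rfl fun c _ => ?_
  convert bad_split n m hm (fun S => ∀ x ∈ S, c - x ∈ S)

/-- For `3 ≤ m ≤ n`, the number of orbits of the dihedral group `D_n` on good binary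
`n`-tuples with exactly `m` ones. -/
theorem dihedral_orbits_m (n m : ℕ) (hm : 3 ≤ m) (hmn : m ≤ n) :
    (Nat.card (Quot (DihedralRelM n m)) : ℚ)
      = (∑ d ∈ (Nat.gcd m n).divisors,
            (Nat.totient d : ℚ) / (2 * n) * ((n / d).choose (m / d)))
        + (1 / 2) *
          (((m / 2 + (n - m) / 2).choose (m / 2) : ℚ)
            - (n / 2).choose (m - 1)
            - (n / 4).choose (m / 2)
            - if Even m then (((n + 2) / 4).choose (m / 2) : ℚ) else 0) := by
  classical
  haveI : NeZero n := ⟨by omega⟩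
  have hB := burnside n m hm
  have h1'' := good_rot_sum n m hm hmn
  have h2'' := good_refl_sum n m hm hmn
  have a1 : n / 2 / 2 = n / 4 := by omega
  have a2 : (n / 2 + 1) / 2 = (n + 2) / 4 := by omega
  rw [a1, a2] at h2''
  have hn : (n : ℚ) ≠ 0 := by
    have : n ≠ 0 := by omega
    exact_mod_cast this
  have e : (∑ d ∈ (Nat.gcd m n).divisors,
      (Nat.totient d : ℚ) / (2 * n) * ((n / d).choose (m / d))) =
      ((∑ d ∈ (Nat.gcd m n).divisors, Nat.totient d * (n / d).choose (m / d) : ℕ) : ℚ) / (2 * n) := by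
    push_cast
    rw [Finset.sum_div]
    refine Finset.sum_congr rfl fun d _ => ?_
    ring
  rw [e]
  have e2 : (if Even m then (((n + 2) / 4).choose (m / 2) : ℚ) else 0) =
      ((if Even m then ((n + 2) / 4).choose (m / 2) else 0 : ℕ) : ℚ) := by
    split_ifs <;> simp
  rw [e2]
  generalize (if Even m then ((n + 2) / 4).choose (m / 2) else 0 : ℕ) = E at *
  generalize (∑ d ∈ (Nat.gcd m n).divisors, Nat.totient d * (n / d).choose (m / d)) = D at *
  qify at hB h1'' h2''
  field_simp
  linear_combination hB + h1'' + h2''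
end

section
/- For n≥3, the number of orbits of the dihedral group D_n on the set of good binary n-tuples equals Σ_{d|n} φ(d)·2^{n/d - 1}/n + 2^{⌊(n-3)/2⌋} - 3·2^{⌊(n-4)/4⌋} if n≡0 or 1 (mod 4), and Σ_{d|n} φ(d)·2^{n/d - 1}/n + 2^{⌊(n-3)/2⌋} - 2^{⌊(n+2)/4⌋} if n≡2 or 3 (mod 4). -/
/-- The dihedral relation on good binary `n`-tuples: two tuples are related iff one is
obtained from the other by a rotation or a reflection of the coordinates. -/
def DihedralRel (n : ℕ) (a b : {a : ZMod n → Bool // GoodFun n a}) : Prop :=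
  ∃ (c : ZMod n) (ε : Bool), ∀ i, b.1 i = a.1 (if ε then c - i else c + i)


theorem quot_invol_iff {α : Type*} (σ : α → α) (hσ : ∀ a, σ (σ a) = a) (a b : α) :
    Quot.mk (fun a b => b = σ a) a = Quot.mk (fun a b => b = σ a) b ↔ b = a ∨ b = σ a := by
  constructor
  · intro h
    have h2 := Quot.eqvGen_exact h
    induction h2 with
    | rel x y h' => exact Or.inr h'
    | refl x => exact Or.inl rfl
    | symm x y _ ih =>
      rcases ih (Quot.eqvGen_sound ‹_›) with h | h
      · exact Or.inl h.symm
      · right; rw [h, hσ]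
    | trans x y z _ _ ih1 ih2 =>
      rcases ih1 (Quot.eqvGen_sound ‹_›) with h | h <;>
      rcases ih2 (Quot.eqvGen_sound ‹_›) with h' | h' <;> subst h <;> subst h' <;> simp [hσ]
  · rintro (h | h)
    · rw [h]
    · exact Quot.sound h

theorem card_quot_invol {α : Type*} [Finite α] (σ : α → α) (hσ : ∀ a, σ (σ a) = a) :
    2 * Nat.card (Quot (fun a b => b = σ a)) = Nat.card α + Nat.card {a // σ a = a} := by
  classical
  have := Fintype.ofFinite α
  have : Fintype (Quot (fun a b => b = σ a)) := Fintype.ofFinite _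
  let p : α → Quot (fun a b => b = σ a) := Quot.mk _
  rw [Nat.card_eq_fintype_card, Nat.card_eq_fintype_card, Nat.card_eq_fintype_card,
    Fintype.card_subtype, ← Finset.card_univ (α := α),
    Finset.card_eq_sum_card_fiberwise (f := p) (s := Finset.univ) (t := Finset.univ) (by simp),
    Finset.card_eq_sum_card_fiberwise (f := p) (t := Finset.univ) (by simp),
    ← Finset.sum_add_distrib]
  rw [Finset.sum_const_nat (m := 2), Finset.card_univ, mul_comm]
  intro q _
  induction q using Quot.ind with
  | mk a =>
    have h1 : ∀ b, p b = Quot.mk _ a ↔ b = a ∨ b = σ a := by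
      intro b
      rw [eq_comm]
      exact quot_invol_iff σ hσ a b
    simp only [h1, Finset.filter_filter]
    by_cases ha : σ a = a
    · have e1 : (Finset.univ.filter fun b => b = a ∨ b = σ a) = {a} := by
        ext b; simp [ha]
      have e2 : (Finset.univ.filter fun b => σ b = b ∧ (b = a ∨ b = σ a)) = {a} := by
        ext b; simp [ha]; rintro rfl; exact ha
      rw [e1, e2]; rfl
    · have e1 : (Finset.univ.filter fun b => b = a ∨ b = σ a) = {a, σ a} := by
        ext b; simp
      have e2 : (Finset.univ.filter fun b => σ b = b ∧ (b = a ∨ b = σ a)) = ∅ := by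
        ext b; simp; intro h; constructor
        · rintro rfl; exact ha h
        · rintro rfl; rw [hσ] at h; exact ha h.symm
      rw [e1, e2, Finset.card_pair (fun h => ha h.symm)]; rfl

theorem card_fix_invol {α : Type*} [Finite α] (σ : α → α) :
    Nat.card {f : α → Bool // ∀ a, f (σ a) = f a}
      = 2 ^ Nat.card (Quot (fun a b => b = σ a)) := by
  have e : {f : α → Bool // ∀ a, f (σ a) = f a} ≃ (Quot (fun a b => b = σ a) → Bool) :=
    { toFun := fun f => Quot.lift f.1 (by rintro a b rfl; exact (f.2 a).symm)
      invFun := fun g => ⟨fun a => g (Quot.mk _ a), fun a => by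
        show g _ = g _
        rw [Quot.sound (r := fun a b => b = σ a) (rfl : σ a = σ a)]⟩
      left_inv := fun f => rfl
      right_inv := fun g => by
        funext q
        induction q using Quot.ind with
        | mk a => rfl }
  rw [Nat.card_congr e, Nat.card_fun]
  simp

theorem card_fix_rot (n : ℕ) [NeZero n] (c : ZMod n) :
    Nat.card {f : ZMod n → Bool // ∀ i, f (i - c) = f i} = 2 ^ (n / addOrderOf c) := by
  have key : ∀ f : ZMod n → Bool, (∀ i, f (i - c) = f i) → ∀ (k : ℤ) i, f (i + k • c) = f i := by
    intro f hf k
    induction k using Int.induction_on with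
    | zero => simp
    | succ k ih =>
      intro i
      rw [← ih i, ← hf (i + ((k : ℤ) + 1) • c)]; congr 1; simp [add_smul]; ring
    | pred k ih =>
      intro i
      rw [← ih i, ← hf (i + (-(k : ℤ)) • c)]; congr 1; simp [sub_smul]; ring
  have e : {f : ZMod n → Bool // ∀ i, f (i - c) = f i} ≃
      ((ZMod n ⧸ AddSubgroup.zmultiples c) → Bool) :=
    { toFun := fun f => Quotient.lift f.1 (by
        intro a b h
        have h := QuotientAddGroup.leftRel_apply.1 h
        obtain ⟨k, hk⟩ := AddSubgroup.mem_zmultiples_iff.1 h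
        have := key f.1 f.2 k a
        rw [hk] at this
        rw [← this]; congr 1; ring)
      invFun := fun g => ⟨fun a => g (QuotientAddGroup.mk a), fun i => by
        show g _ = g _
        have : (QuotientAddGroup.mk (i - c) : ZMod n ⧸ AddSubgroup.zmultiples c)
            = QuotientAddGroup.mk i := by
          rw [QuotientAddGroup.eq]
          simp
        rw [this]⟩
      left_inv := fun f => rfl
      right_inv := fun g => by
        funext q
        induction q using Quotient.inductionOn with
        | h a => rfl }
  rw [Nat.card_congr e, Nat.card_fun]
  have h := AddSubgroup.card_eq_card_quotient_mul_card_addSubgroup (AddSubgroup.zmultiples c)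
  rw [Nat.card_zmultiples, Nat.card_zmod] at h
  have hpos : 0 < addOrderOf c := addOrderOf_pos c
  have : n / addOrderOf c = Nat.card (ZMod n ⧸ AddSubgroup.zmultiples c) := by
    exact Nat.div_eq_of_eq_mul_left hpos h
  rw [this]; simp

theorem sum_fix_rot (n : ℕ) [NeZero n] :
    ∑ c : ZMod n, 2 ^ (n / addOrderOf c) = ∑ d ∈ n.divisors, d.totient * 2 ^ (n / d) := by
  rw [← Finset.sum_fiberwise_of_maps_to (s := Finset.univ) (t := n.divisors)
    (g := fun c : ZMod n => addOrderOf c)]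
  · apply Finset.sum_congr rfl
    intro d hd
    rw [Finset.sum_congr rfl (g := fun _ => 2 ^ (n / d))]
    · rw [Finset.sum_const, IsAddCyclic.card_addOrderOf_eq_totient, smul_eq_mul]
      rw [ZMod.card]; exact (Nat.mem_divisors.1 hd).1
    · intro c hc
      simp at hc
      rw [hc]
  · intro c _
    rw [Nat.mem_divisors]
    refine ⟨?_, NeZero.ne n⟩
    have := addOrderOf_dvd_natCard c
    rwa [Nat.card_zmod] at this

theorem card_fix_refl (n : ℕ) [NeZero n] (c : ZMod n) :
    Nat.card {f : ZMod n → Bool // ∀ i, f (-i - c) = f i}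
      = 2 ^ ((n + Nat.card {i : ZMod n // -i - c = i}) / 2) := by
  have h := card_quot_invol (fun i : ZMod n => -i - c) (by intro a; ring)
  rw [Nat.card_zmod] at h
  have h2 := card_fix_invol (fun i : ZMod n => -i - c)
  rw [h2, ← h]
  simp

theorem sum_fix_refl_odd (m : ℕ) :
    ∑ c : ZMod (2*m+1), 2 ^ (((2*m+1) + Nat.card {i : ZMod (2*m+1) // -i - c = i}) / 2)
      = (2*m+1) * 2^(m+1) := by
  rw [Finset.sum_const_nat (m := 2^(m+1))]
  · simp [ZMod.card]
  · intro c _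
    have hm : (2 * (m:ZMod (2*m+1)) + 1) = 0 := by
      have := ZMod.natCast_self (2*m+1)
      push_cast at this; exact this
    have : Nat.card {i : ZMod (2*m+1) // -i - c = i} = 1 := by
      rw [Nat.card_eq_one_iff_exists]
      refine ⟨⟨m * c, ?_⟩, ?_⟩
      · linear_combination (-c) * hm
      · rintro ⟨i, hi⟩
        apply Subtype.ext
        simp only
        linear_combination (i) * hm + m * hi
    rw [this]
    congr 1
    omega

theorem sum_range_alt (m : ℕ) :
    ∑ c ∈ Finset.range (2*m), (if c % 2 = 0 then 2^(k+1) else 2^k) = 3 * m * 2^k := by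
  induction m with
  | zero => simp
  | succ m ih =>
    rw [show 2*(m+1) = 2*m+1+1 by ring, Finset.sum_range_succ, Finset.sum_range_succ, ih]
    rw [if_pos (by omega), if_neg (by omega)]
    ring

theorem sum_fix_refl_even (m : ℕ) (hm : 0 < m) [NeZero (2*m)] :
    ∑ c : ZMod (2*m), 2 ^ (((2*m) + Nat.card {i : ZMod (2*m) // -i - c = i}) / 2)
      = 3 * m * 2^m := by
  have hcard : ∀ c : ZMod (2*m), Nat.card {i : ZMod (2*m) // -i - c = i}
      = if c.val % 2 = 0 then 2 else 0 := by
    intro c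
    have h0 : ∀ i : ZMod (2*m), -i - c = i ↔ (2*m) ∣ (2 * i.val + c.val) := by
      intro i
      rw [← ZMod.natCast_eq_zero_iff]
      push_cast
      rw [ZMod.natCast_zmod_val, ZMod.natCast_zmod_val]
      constructor
      · intro h; linear_combination -h
      · intro h; linear_combination -h
    have hc := ZMod.val_lt c
    split_ifs with h
    · rw [Nat.card_eq_two_iff]
      obtain ⟨t, ht⟩ : ∃ t, c.val = 2 * t := ⟨c.val / 2, by omega⟩
      have v1 : ((m - t : ℕ) : ZMod (2*m)).val = m - t := ZMod.val_cast_of_lt (by omega)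
      by_cases ht0 : t = 0
      · subst ht0
        have v2 : ((0 : ℕ) : ZMod (2*m)).val = 0 := ZMod.val_cast_of_lt (by omega)
        refine ⟨⟨((m - 0 : ℕ) : ZMod (2*m)), ?_⟩, ⟨((0 : ℕ) : ZMod (2*m)), ?_⟩, ?_, ?_⟩
        · rw [h0, v1, ht]; exact ⟨1, by omega⟩
        · rw [h0, v2, ht]; simp
        · intro h
          have := congrArg (fun x => ZMod.val x.1) h
          simp only [v1, v2] at this
          omega
        · rw [Set.eq_univ_iff_forall]
          rintro ⟨i, hi⟩
          have := (h0 i).1 hi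
          have hi2 := ZMod.val_lt i
          obtain ⟨q, hq⟩ := this
          simp only [Set.mem_insert_iff, Set.mem_singleton_iff, Subtype.mk.injEq]
          rw [← (ZMod.val_injective (2*m)).eq_iff, ← (ZMod.val_injective (2*m)).eq_iff, v1, v2]
          have : q < 2 := by nlinarith
          interval_cases q <;> omega
      · have v2 : ((2*m - t : ℕ) : ZMod (2*m)).val = 2*m-t := ZMod.val_cast_of_lt (by omega)
        refine ⟨⟨((m - t : ℕ) : ZMod (2*m)), ?_⟩, ⟨((2*m-t : ℕ) : ZMod (2*m)), ?_⟩, ?_, ?_⟩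
        · rw [h0, v1, ht]; exact ⟨1, by omega⟩
        · rw [h0, v2, ht]; exact ⟨2, by omega⟩
        · intro h
          have := congrArg (fun x => ZMod.val x.1) h
          simp only [v1, v2] at this
          omega
        · rw [Set.eq_univ_iff_forall]
          rintro ⟨i, hi⟩
          have := (h0 i).1 hi
          have hi2 := ZMod.val_lt i
          obtain ⟨q, hq⟩ := this
          simp only [Set.mem_insert_iff, Set.mem_singleton_iff, Subtype.mk.injEq]
          rw [← (ZMod.val_injective (2*m)).eq_iff, ← (ZMod.val_injective (2*m)).eq_iff, v1, v2]
          have : q < 3 := by nlinarith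
          interval_cases q <;> omega
    · have : IsEmpty {i : ZMod (2*m) // -i - c = i} := by
        constructor
        rintro ⟨i, hi⟩
        have := (h0 i).1 hi
        have := dvd_trans (Dvd.intro m rfl : 2 ∣ 2 * m) this
        omega
      exact Nat.card_of_isEmpty
  rw [← sum_range_alt (k := m), Finset.sum_range]
  have e : Fin (2*m) ≃ ZMod (2*m) :=
    { toFun := fun i => ((i.1 : ℕ) : ZMod (2*m))
      invFun := fun c => ⟨c.val, ZMod.val_lt c⟩
      left_inv := fun i => Fin.ext (ZMod.val_cast_of_lt i.2)
      right_inv := fun c => by simp }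
  symm
  apply Finset.sum_bij (fun (i : Fin (2*m)) _ => ((i.1 : ℕ) : ZMod (2*m)))
  · simp
  · intro a _ b _ h
    have := congrArg ZMod.val h
    rw [ZMod.val_cast_of_lt a.2, ZMod.val_cast_of_lt b.2] at this
    exact Fin.ext this
  · intro c _
    exact ⟨⟨c.val, ZMod.val_lt c⟩, by simp, by simp⟩
  · intro a _
    rw [hcard, ZMod.val_cast_of_lt a.2]
    split_ifs
    · congr 1; omega
    · congr 1; omega

@[reducible]
def dihAct (n : ℕ) : MulAction (DihedralGroup n) (ZMod n → Bool) where
  smul g f := match g with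
    | .r c => fun i => f (i - c)
    | .sr c => fun i => f (-i - c)
  one_smul f := by
    show (fun i => f (i - 0)) = f
    simp
  mul_smul := by
    rintro (a | a) (b | b) f
    · show (fun i => f (i - (a + b))) = fun i => f (i - a - b)
      funext i; congr 1; ring
    · show (fun i => f (-i - (b - a))) = fun i => f (-(i - a) - b)
      funext i; congr 1; ring
    · show (fun i => f (-i - (a + b))) = fun i => f (-i - a - b)
      funext i; congr 1; ring
    · show (fun i => f (i - (b - a))) = fun i => f (-(-i - a) - b)
      funext i; congr 1; ring

/-- the dihedral equivalence of tuples -/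
def dihSetoid (n : ℕ) : Setoid (ZMod n → Bool) :=
  @MulAction.orbitRel (DihedralGroup n) (ZMod n → Bool) _ (dihAct n)

theorem dihSetoid_iff (n : ℕ) (a b : ZMod n → Bool) :
    (dihSetoid n).r a b ↔ ∃ (c : ZMod n) (ε : Bool), ∀ i, b i = a (if ε then c - i else c + i) := by
  constructor
  · intro h
    obtain ⟨g, hg⟩ := (dihSetoid n).symm h
    rcases g with c | c
    · refine ⟨-c, false, fun i => ?_⟩
      rw [← hg]
      show a (i - c) = _
      simp; congr 1; ring
    · refine ⟨-c, true, fun i => ?_⟩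
      rw [← hg]
      show a (-i - c) = _
      simp; congr 1; ring
  · rintro ⟨c, ε, h⟩
    apply (dihSetoid n).symm
    cases ε
    · refine ⟨.r (-c), ?_⟩
      funext i
      rw [h]
      show a (i - -c) = _
      simp; congr 1; ring
    · refine ⟨.sr (-c), ?_⟩
      funext i
      rw [h]
      show a (-i - -c) = _
      simp; congr 1; ring

theorem card_all (n : ℕ) [NeZero n] :
    Nat.card (Quotient (dihSetoid n)) * (2 * n) =
      ∑ d ∈ n.divisors, d.totient * 2 ^ (n / d) +
      ∑ c : ZMod n, 2 ^ ((n + Nat.card {i : ZMod n // -i - c = i}) / 2) := by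
  classical
  let _ := dihAct n
  have : Fintype (Quotient (MulAction.orbitRel (DihedralGroup n) (ZMod n → Bool))) :=
    Fintype.ofFinite _
  have h := MulAction.sum_card_fixedBy_eq_card_orbits_mul_card_group (DihedralGroup n)
    (ZMod n → Bool)
  rw [DihedralGroup.card] at h
  have h' : Nat.card (Quotient (dihSetoid n)) =
    Fintype.card (Quotient (MulAction.orbitRel (DihedralGroup n) (ZMod n → Bool))) := by
    rw [← Nat.card_eq_fintype_card]; rfl
  rw [h', ← h, ← sum_fix_rot]
  let e : ZMod n ⊕ ZMod n ≃ DihedralGroup n :=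
    { toFun := fun x => match x with
        | .inl c => .r c
        | .inr c => .sr c
      invFun := fun x => match x with
        | .r c => .inl c
        | .sr c => .inr c
      left_inv := by rintro (c | c) <;> rfl
      right_inv := by rintro (c | c) <;> rfl }
  rw [← Equiv.sum_comp e, Fintype.sum_sum_type]
  congr 1
  · apply Finset.sum_congr rfl
    intro c _
    rw [← card_fix_rot, ← Nat.card_eq_fintype_card]
    apply Nat.card_congr
    apply Equiv.subtypeEquivRight
    intro f
    exact funext_iff
  · apply Finset.sum_congr rfl
    intro c _
    rw [← card_fix_refl, ← Nat.card_eq_fintype_card]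
    apply Nat.card_congr
    apply Equiv.subtypeEquivRight
    intro f
    exact funext_iff

/-- normal forms of bad tuples -/
def NF (m : ℕ) : Finset (Finset ℕ) :=
  insert ∅ ((Finset.Icc 1 m).powerset.image (insert 0))

theorem mem_NF (m : ℕ) (S : Finset ℕ) : S ∈ NF m ↔ S = ∅ ∨ (0 ∈ S ∧ ∀ x ∈ S, x ≤ m) := by
  unfold NF
  rw [Finset.mem_insert, Finset.mem_image]
  apply or_congr Iff.rfl
  constructor
  · rintro ⟨U, hU, rfl⟩
    rw [Finset.mem_powerset] at hU
    refine ⟨by simp, fun x hx => ?_⟩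
    rcases Finset.mem_insert.1 hx with h | h
    · omega
    · exact (Finset.mem_Icc.1 (hU h)).2
  · rintro ⟨h0, h⟩
    refine ⟨S.erase 0, ?_, Finset.insert_erase h0⟩
    rw [Finset.mem_powerset]
    intro x hx
    have h1 := Finset.mem_erase.1 hx
    have := h x h1.2
    rw [Finset.mem_Icc]; omega

theorem card_NF (m : ℕ) : (NF m).card = 2 ^ m + 1 := by
  unfold NF
  rw [Finset.card_insert_of_notMem, Finset.card_image_of_injOn, Finset.card_powerset]
  · simp
  · intro U hU V hV h
    have h0 : ∀ W : Finset ℕ, W ∈ (((Finset.Icc 1 m).powerset : Finset _) : Set (Finset ℕ)) →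
        0 ∉ W := by
      intro W hW h0
      have := Finset.mem_Icc.1 (Finset.mem_powerset.1 (Finset.mem_coe.1 hW) h0)
      omega
    have := congrArg (fun W => Finset.erase W 0) h
    simpa [Finset.erase_insert, h0 U hU, h0 V hV] using this
  · intro h
    obtain ⟨U, _, hU⟩ := Finset.mem_image.1 h
    exact Finset.insert_ne_empty _ _ hU

/-- reversal of a finite set -/
def flipSet (S : Finset ℕ) : Finset ℕ := S.image (fun x => S.sup id - x)

theorem le_sup_id {S : Finset ℕ} {x : ℕ} (h : x ∈ S) : x ≤ S.sup id :=
  Finset.le_sup (f := id) h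

theorem sup_id_mem {S : Finset ℕ} (h : S.Nonempty) : S.sup id ∈ S := by
  obtain ⟨x, hx, h⟩ := Finset.exists_mem_eq_sup S h id
  rw [h]; exact hx

theorem sup_id_eq {S : Finset ℕ} {L : ℕ} (h : L ∈ S) (h' : ∀ x ∈ S, x ≤ L) : S.sup id = L :=
  le_antisymm (Finset.sup_le h') (le_sup_id h)

theorem mem_flip {S : Finset ℕ} {x : ℕ} :
    x ∈ flipSet S ↔ x ≤ S.sup id ∧ S.sup id - x ∈ S := by
  unfold flipSet
  rw [Finset.mem_image]
  constructor
  · rintro ⟨y, hy, rfl⟩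
    have := le_sup_id hy
    refine ⟨by omega, ?_⟩
    rwa [show S.sup id - (S.sup id - y) = y by omega]
  · rintro ⟨h1, h2⟩
    exact ⟨_, h2, by omega⟩

theorem flip_empty : flipSet ∅ = ∅ := rfl

theorem sup_flip {S : Finset ℕ} (h0 : 0 ∈ S) : (flipSet S).sup id = S.sup id := by
  apply sup_id_eq
  · rw [mem_flip]; simpa using h0
  · intro x hx; exact (mem_flip.1 hx).1

theorem flipSet_flipSet {S : Finset ℕ} (h0 : 0 ∈ S) : flipSet (flipSet S) = S := by
  ext x
  rw [mem_flip, sup_flip h0, mem_flip]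
  constructor
  · rintro ⟨h1, h2, h3⟩
    rwa [show S.sup id - (S.sup id - x) = x by omega] at h3
  · intro h
    have := le_sup_id h
    refine ⟨this, by omega, ?_⟩
    rwa [show S.sup id - (S.sup id - x) = x by omega]

theorem flip_mem_NF {m : ℕ} {S : Finset ℕ} (h : S ∈ NF m) : flipSet S ∈ NF m := by
  rw [mem_NF] at h ⊢
  rcases h with h | ⟨h0, h⟩
  · left; rw [h]; rfl
  · right
    have hL := sup_id_mem ⟨0, h0⟩
    refine ⟨mem_flip.2 ⟨by omega, by simpa using hL⟩, fun x hx => ?_⟩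
    exact (mem_flip.1 hx).1.trans (h _ hL)

theorem flipSet_flipSet_NF {m : ℕ} {S : Finset ℕ} (h : S ∈ NF m) : flipSet (flipSet S) = S := by
  rcases (mem_NF _ _).1 h with h | ⟨h0, h⟩
  · rw [h]; rfl
  · exact flipSet_flipSet h0

theorem fiber_iff {m L : ℕ} (hL : L ≤ m) (S : Finset ℕ) :
    (S ∈ NF m ∧ flipSet S = S ∧ S ≠ ∅) ∧ S.sup id = L ↔
      (∀ x ∈ S, x ≤ L) ∧ 0 ∈ S ∧ L ∈ S ∧ ∀ x ≤ L, (x ∈ S ↔ L - x ∈ S) := by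
  constructor
  · rintro ⟨⟨h1, h2, h3⟩, rfl⟩
    rw [mem_NF] at h1
    obtain ⟨h0, h⟩ := h1.resolve_left h3
    refine ⟨fun x hx => le_sup_id hx, h0, sup_id_mem ⟨0, h0⟩, fun x hx => ?_⟩
    conv_lhs => rw [← h2]
    rw [mem_flip]; simp [hx]
  · rintro ⟨h1, h0, h2, h3⟩
    have hs := sup_id_eq h2 h1
    refine ⟨⟨?_, ?_, Finset.ne_empty_of_mem h0⟩, hs⟩
    · rw [mem_NF]; exact Or.inr ⟨h0, fun x hx => (h1 x hx).trans hL⟩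
    · ext x
      rw [mem_flip, hs]
      constructor
      · rintro ⟨h, h'⟩; exact (h3 x h).2 h'
      · intro h; exact ⟨h1 x h, (h3 x (h1 x h)).1 h⟩

theorem card_fiber {m L : ℕ} (hL : L ≤ m) :
    (((NF m).filter fun S => flipSet S = S ∧ S ≠ ∅).filter fun S => S.sup id = L).card
      = 2 ^ (L / 2) := by
  have hc : ((Finset.Icc 1 (L/2)).powerset).card = 2 ^ (L/2) := by simp
  rw [← hc]
  have hm : ∀ S, S ∈ (((NF m).filter fun S => flipSet S = S ∧ S ≠ ∅).filter
      fun S => S.sup id = L) ↔ (∀ x ∈ S, x ≤ L) ∧ 0 ∈ S ∧ L ∈ S ∧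
        ∀ x ≤ L, (x ∈ S ↔ L - x ∈ S) := by
    intro S
    rw [Finset.mem_filter, Finset.mem_filter, fiber_iff hL]
  apply Finset.card_bij' (fun S _ => S ∩ Finset.Icc 1 (L/2))
    (fun U _ => (Finset.range (L+1)).filter fun x => x = 0 ∨ x = L ∨ x ∈ U ∨ L - x ∈ U)
  · intro S _
    rw [Finset.mem_powerset]; exact Finset.inter_subset_right
  · intro U hU
    rw [Finset.mem_powerset] at hU
    rw [hm]
    refine ⟨?_, by simp, by simp, ?_⟩
    · intro x hx
      simp at hx; omega
    · intro x hx
      simp only [Finset.mem_filter, Finset.mem_range]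
      rw [show L - (L - x) = x by omega]
      constructor
      · rintro ⟨_, h | h | h | h⟩
        · exact ⟨by omega, by omega⟩
        · exact ⟨by omega, by omega⟩
        · exact ⟨by omega, by tauto⟩
        · exact ⟨by omega, by tauto⟩
      · rintro ⟨_, h | h | h | h⟩
        · exact ⟨by omega, by omega⟩
        · exact ⟨by omega, by omega⟩
        · exact ⟨by omega, by tauto⟩
        · exact ⟨by omega, by tauto⟩
  · intro S hS
    rw [hm] at hS
    obtain ⟨h1, h0, hLS, h3⟩ := hS
    ext x
    simp only [Finset.mem_filter, Finset.mem_range, Finset.mem_inter, Finset.mem_Icc]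
    constructor
    · rintro ⟨hx, rfl | rfl | h | h⟩
      · exact h0
      · exact hLS
      · exact h.1
      · exact (h3 x (by omega)).2 h.1
    · intro h
      have := h1 x h
      refine ⟨by omega, ?_⟩
      by_cases hx0 : x = 0
      · exact Or.inl hx0
      by_cases hxL : x = L
      · exact Or.inr (Or.inl hxL)
      right; right
      by_cases hh : x ≤ L/2
      · exact Or.inl ⟨h, by omega, hh⟩
      · exact Or.inr ⟨(h3 x this).1 h, by omega, by omega⟩
  · intro U hU
    rw [Finset.mem_powerset] at hU
    have hU' : ∀ x ∈ U, 1 ≤ x ∧ x ≤ L/2 := fun x hx => Finset.mem_Icc.1 (hU hx)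
    ext x
    simp only [Finset.mem_filter, Finset.mem_range, Finset.mem_inter, Finset.mem_Icc]
    constructor
    · rintro ⟨⟨h1, h | h | h | h⟩, h2, h3⟩
      · omega
      · omega
      · exact h
      · have := hU' _ h
        rwa [show L - x = x by omega] at h
    · intro h
      have := hU' _ h
      exact ⟨⟨by omega, by tauto⟩, by omega, by omega⟩

theorem card_pal (m : ℕ) :
    ((NF m).filter fun S => flipSet S = S).card
      = 1 + ∑ L ∈ Finset.range (m+1), 2 ^ (L/2) := by
  have h1 : ((NF m).filter fun S => flipSet S = S)
      = insert ∅ ((NF m).filter fun S => flipSet S = S ∧ S ≠ ∅) := by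
    ext S
    simp only [Finset.mem_filter, Finset.mem_insert]
    constructor
    · rintro ⟨a, b⟩
      by_cases h : S = ∅
      · exact Or.inl h
      · exact Or.inr ⟨a, b, h⟩
    · rintro (h | h)
      · subst h
        exact ⟨by rw [mem_NF]; exact Or.inl rfl, rfl⟩
      · exact ⟨h.1, h.2.1⟩
  rw [h1, Finset.card_insert_of_notMem (by simp), add_comm]
  congr 1
  rw [Finset.card_eq_sum_card_fiberwise (f := fun S => S.sup id) (t := Finset.range (m+1))]
  · apply Finset.sum_congr rfl
    intro L hL
    exact card_fiber (by rw [Finset.mem_range] at hL; omega)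
  · intro S hS
    have hS := Finset.mem_filter.1 (Finset.mem_coe.1 hS)
    have := ((mem_NF m S).1 hS.1).resolve_left hS.2.2
    have := this.2 _ (sup_id_mem ⟨0, this.1⟩)
    simp only [Finset.coe_range, Set.mem_Iio]; omega

/-- the flip on the type of normal forms -/
def flipNF (m : ℕ) (S : {S // S ∈ NF m}) : {S // S ∈ NF m} := ⟨flipSet S.1, flip_mem_NF S.2⟩

theorem card_quot_NF (m : ℕ) :
    2 * Nat.card (Quot (fun a b => b = flipNF m a))
      = 2 ^ m + 2 + ∑ L ∈ Finset.range (m+1), 2 ^ (L/2) := by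
  rw [card_quot_invol (flipNF m) (fun a => Subtype.ext (flipSet_flipSet_NF a.2))]
  have h1 : Nat.card {S // S ∈ NF m} = 2 ^ m + 1 := by
    rw [← card_NF m]; simp
  have h2 : Nat.card {a // flipNF m a = a} = 1 + ∑ L ∈ Finset.range (m+1), 2 ^ (L/2) := by
    rw [← card_pal m]
    have e : {a // flipNF m a = a} ≃ {S // S ∈ (NF m).filter fun S => flipSet S = S} :=
      { toFun := fun a => ⟨a.1.1, Finset.mem_filter.2 ⟨a.1.2, congrArg Subtype.val a.2⟩⟩
        invFun := fun S => ⟨⟨S.1, (Finset.mem_filter.1 S.2).1⟩,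
          Subtype.ext (Finset.mem_filter.1 S.2).2⟩
        left_inv := fun _ => rfl
        right_inv := fun _ => rfl }
    rw [Nat.card_congr e, Nat.card_eq_fintype_card, Fintype.card_coe]
  rw [h1, h2]; ring

/-- tuple of a set -/
def tup (n : ℕ) (S : Finset ℕ) : ZMod n → Bool := fun i => decide (i.val ∈ S)

theorem tup_iff {n : ℕ} {S : Finset ℕ} {i : ZMod n} : tup n S i = true ↔ i.val ∈ S := by
  simp [tup]

theorem tup_flip (n : ℕ) [NeZero n] (hn : 3 ≤ n) (S : Finset ℕ) (hS : S ∈ NF (n/2)) (i : ZMod n) :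
    tup n (flipSet S) i = tup n S (((S.sup id : ℕ) : ZMod n) - i) := by
  rcases (mem_NF _ _).1 hS with h | ⟨h0, h⟩
  · subst h; simp [tup, flip_empty]
  have hL := h _ (sup_id_mem ⟨0, h0⟩)
  set L := S.sup id with hLdef
  rw [Bool.eq_iff_iff, tup_iff, tup_iff, mem_flip, ← hLdef]
  have hi := ZMod.val_lt i
  by_cases hh : i.val ≤ L
  · have : (L : ZMod n) - i = ((L - i.val : ℕ) : ZMod n) := by
      rw [Nat.cast_sub hh, ZMod.natCast_zmod_val]
    rw [this, ZMod.val_cast_of_lt (by omega)]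
    simp [hh]
  · have : (L : ZMod n) - i = ((n + L - i.val : ℕ) : ZMod n) := by
      rw [Nat.cast_sub (by omega), ZMod.natCast_zmod_val]; simp
    rw [this, ZMod.val_cast_of_lt (by omega)]
    constructor
    · intro h; exact absurd h.1 hh
    · intro h'
      have := le_sup_id h'
      omega

theorem tup_rot_bad (n : ℕ) [NeZero n] (hn : 3 ≤ n) (S : Finset ℕ) (hS : S ∈ NF (n/2)) (c : ZMod n)
    (b : ZMod n → Bool) (hb : ∀ i, b i = tup n S (c + i)) : ¬ GoodFun n b := by
  rintro ⟨⟨i, hi⟩, h⟩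
  rw [hb, tup_iff] at hi
  have hne : S ≠ ∅ := Finset.ne_empty_of_mem hi
  obtain ⟨h0, hm⟩ := ((mem_NF _ _).1 hS).resolve_left hne
  have hLS := sup_id_mem ⟨0, h0⟩
  have hL := hm _ hLS
  set L := S.sup id with hLdef
  obtain ⟨k, hk, hkn, hh⟩ := h (L - c) (by
    rw [hb, tup_iff, show c + ((L : ZMod n) - c) = ((L : ℕ) : ZMod n) by ring,
      ZMod.val_cast_of_lt (by omega)]
    exact hLS)
  rw [hb, tup_iff, show c + ((L : ZMod n) - c + k) = ((L + k : ℕ) : ZMod n) by push_cast; ring,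
      ZMod.val_cast_of_lt (by omega)] at hh
  have := le_sup_id hh
  omega

theorem tup_rel_bad (n : ℕ) [NeZero n] (hn : 3 ≤ n) (S : Finset ℕ) (hS : S ∈ NF (n/2))
    (b : ZMod n → Bool) (hb : (dihSetoid n).r (tup n S) b) : ¬ GoodFun n b := by
  obtain ⟨c, ε, h⟩ := (dihSetoid_iff n _ _).1 hb
  cases ε
  · exact tup_rot_bad n hn S hS c b (by simpa using h)
  · apply tup_rot_bad n hn (flipSet S) (flip_mem_NF hS) (((S.sup id : ℕ) : ZMod n) - c) b
    intro i
    rw [h, tup_flip n hn S hS]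
    simp only [if_true]
    congr 1; ring

theorem bad_exists (n : ℕ) [NeZero n] (hn : 3 ≤ n) (b : ZMod n → Bool) (hb : ¬ GoodFun n b) :
    ∃ S ∈ NF (n/2), (dihSetoid n).r b (tup n S) := by
  unfold GoodFun at hb
  by_cases h0 : ∃ i, b i = true
  · have hb := not_and.1 hb h0
    push Not at hb
    obtain ⟨i, hi, h⟩ := hb
    refine ⟨(Finset.range (n/2+1)).filter fun j => b (i - (j : ZMod n)) = true, ?_, ?_⟩
    · rw [mem_NF]
      right
      refine ⟨by simp [hi], fun x hx => ?_⟩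
      simp at hx; omega
    · rw [dihSetoid_iff]
      refine ⟨i, true, fun x => ?_⟩
      rw [Bool.eq_iff_iff, tup_iff]
      simp only [Finset.mem_filter, Finset.mem_range, ZMod.natCast_zmod_val, if_true]
      constructor
      · exact fun h => h.2
      · intro hx
        refine ⟨?_, hx⟩
        by_contra hc
        have hx2 := ZMod.val_lt x
        have := h (n - x.val) (by omega) (by omega)
        apply this
        rw [Nat.cast_sub hx2.le, ZMod.natCast_zmod_val]
        simpa [sub_eq_add_neg] using hx
  · push Not at h0
    refine ⟨∅, (mem_NF _ _).2 (Or.inl rfl), ?_⟩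
    rw [dihSetoid_iff]
    refine ⟨0, false, fun i => ?_⟩
    simp only [Bool.not_eq_true] at h0
    rw [h0]; simp [tup]

theorem rot_eq (n : ℕ) [NeZero n] (hn : 3 ≤ n) (S T : Finset ℕ) (hS : S ∈ NF (n/2))
    (hT : T ∈ NF (n/2)) (c : ZMod n) (h : ∀ i, tup n T i = tup n S (c + i)) : T = S := by
  have key : ∀ x < n, (x ∈ T ↔ (c.val + x) % n ∈ S) := by
    intro x hx
    have := h (x : ZMod n)
    rw [Bool.eq_iff_iff, tup_iff, tup_iff, ZMod.val_cast_of_lt hx, ZMod.val_add,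
      ZMod.val_cast_of_lt hx] at this
    exact this
  have hc := ZMod.val_lt c
  set d := c.val with hd
  rcases (mem_NF _ _).1 hT with rfl | ⟨h0T, hmT⟩
  · symm
    rw [Finset.eq_empty_iff_forall_notMem]
    intro x hx
    have hx' : x ≤ n/2 := by
      rcases (mem_NF _ _).1 hS with rfl | ⟨h0, hm⟩
      · simp at hx
      · exact hm x hx
    by_cases hdx : d ≤ x
    · have := (key (x - d) (by omega)).2 (by
        rw [show d + (x - d) = x by omega, Nat.mod_eq_of_lt (by omega)]; exact hx)
      simp at this
    · have := (key (n + x - d) (by omega)).2 (by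
        rw [show d + (n + x - d) = x + n by omega, Nat.add_mod_right,
          Nat.mod_eq_of_lt (by omega)]; exact hx)
      simp at this
  · have hdS : d ∈ S := by
      have := (key 0 (by omega)).1 h0T
      rwa [add_zero, Nat.mod_eq_of_lt hc] at this
    obtain ⟨h0S, hmS⟩ := ((mem_NF _ _).1 hS).resolve_left (Finset.ne_empty_of_mem hdS)
    have hdm := hmS d hdS
    by_cases hd0 : d = 0
    · ext x
      by_cases hx : x < n
      · rw [key x hx, hd0, zero_add, Nat.mod_eq_of_lt hx]
      · constructor
        · intro h; have := hmT x h; omega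
        · intro h; have := hmS x h; omega
    · have ht : n - d ∈ T := (key (n - d) (by omega)).2 (by
        rw [show d + (n - d) = n by omega, Nat.mod_self]; exact h0S)
      have := hmT _ ht
      have hdn : n = 2 * d := by omega
      have hT' : ∀ x ∈ T, x = 0 ∨ x = d := by
        intro x hx
        have h1 := hmT x hx
        by_contra hcon
        have h2 := (key x (by omega)).1 hx
        rw [Nat.mod_eq_of_lt (by omega)] at h2
        have := hmS _ h2
        omega
      have hS' : ∀ x ∈ S, x = 0 ∨ x = d := by
        intro x hx
        have h1 := hmS x hx
        by_contra hcon
        have h2 := (key (x + d) (by omega)).2 (by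
          rw [show d + (x + d) = x + n by omega, Nat.add_mod_right,
            Nat.mod_eq_of_lt (by omega)]; exact hx)
        have := hmT _ h2
        omega
      have hdT : d ∈ T := by rwa [show n - d = d by omega] at ht
      ext x
      constructor
      · intro hx
        rcases hT' x hx with rfl | rfl
        · exact h0S
        · exact hdS
      · intro hx
        rcases hS' x hx with h | h
        · rw [h]; exact h0T
        · rw [h]; exact hdT

theorem tup_rel_iff (n : ℕ) [NeZero n] (hn : 3 ≤ n) (S T : Finset ℕ) (hS : S ∈ NF (n/2))
    (hT : T ∈ NF (n/2)) : (dihSetoid n).r (tup n S) (tup n T) ↔ T = S ∨ T = flipSet S := by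
  rw [dihSetoid_iff]
  constructor
  · rintro ⟨c, ε, h⟩
    cases ε
    · left; exact rot_eq n hn S T hS hT c (by simpa using h)
    · right
      apply rot_eq n hn (flipSet S) T (flip_mem_NF hS) hT (((S.sup id : ℕ) : ZMod n) - c)
      intro i
      rw [h, tup_flip n hn S hS]
      simp only [if_true]
      congr 1; ring
  · rintro (rfl | rfl)
    · exact ⟨0, false, by simp⟩
    · exact ⟨((S.sup id : ℕ) : ZMod n), true, fun i => by rw [tup_flip n hn S hS]; simp⟩

/-- classes of bad tuples -/
def BadCls (n : ℕ) (q : Quotient (dihSetoid n)) : Prop :=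
  ∃ S ∈ NF (n/2), q = Quotient.mk (dihSetoid n) (tup n S)

theorem good_iff (n : ℕ) [NeZero n] (hn : 3 ≤ n) (a : ZMod n → Bool) :
    GoodFun n a ↔ ¬ BadCls n (Quotient.mk (dihSetoid n) a) := by
  rw [← not_iff_not, not_not]
  constructor
  · intro h
    obtain ⟨S, hS, hr⟩ := bad_exists n hn a h
    exact ⟨S, hS, Quotient.sound hr⟩
  · rintro ⟨S, hS, hr⟩
    exact tup_rel_bad n hn S hS a ((dihSetoid n).symm (Quotient.exact hr))

theorem card_bad (n : ℕ) [NeZero n] (hn : 3 ≤ n) :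
    Nat.card {q // BadCls n q} = Nat.card (Quot (fun a b => b = flipNF (n/2) a)) := by
  symm
  let F : {S // S ∈ NF (n/2)} → {q // BadCls n q} := fun S =>
    ⟨Quotient.mk (dihSetoid n) (tup n S.1), S.1, S.2, rfl⟩
  have hF : ∀ S T, F S = F T ↔ T = S ∨ T = flipNF (n/2) S := by
    intro S T
    rw [Subtype.ext_iff, Quotient.eq]
    have := tup_rel_iff n hn S.1 T.1 S.2 T.2
    rw [Subtype.ext_iff, Subtype.ext_iff]
    exact this
  apply Nat.card_eq_of_bijective
    (Quot.lift F (fun S T h => (hF S T).2 (Or.inr h)))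
  constructor
  · intro p q
    induction p using Quot.ind with
    | mk S =>
      induction q using Quot.ind with
      | mk T =>
        intro h
        have h := (hF S T).1 h
        rcases h with h | h
        · rw [h]
        · exact Quot.sound h
  · rintro ⟨q, S, hS, rfl⟩
    exact ⟨Quot.mk _ ⟨S, hS⟩, rfl⟩

theorem card_good (n : ℕ) [NeZero n] (hn : 3 ≤ n) :
    Nat.card (Quot (DihedralRel n)) = Nat.card {q // ¬ BadCls n q} := by
  symm
  let s₂ : Setoid {a // GoodFun n a} := Setoid.comap Subtype.val (dihSetoid n)
  have e1 := Equiv.subtypeQuotientEquivQuotientSubtype (GoodFun n) (s₁ := dihSetoid n) (s₂ := s₂)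
    (fun q => ¬ BadCls n q) (good_iff n hn) (fun x y => Iff.rfl)
  have e2 : Quotient s₂ ≃ Quot (DihedralRel n) :=
    Quot.congrRight (fun x y => dihSetoid_iff n x.1 y.1)
  exact Nat.card_congr (e1.trans e2)

theorem card_total (n : ℕ) [NeZero n] (hn : 3 ≤ n) :
    2 * Nat.card (Quotient (dihSetoid n)) = 2 * Nat.card (Quot (DihedralRel n)) +
      (2 ^ (n/2) + 2 + ∑ L ∈ Finset.range (n/2+1), 2 ^ (L/2)) := by
  classical
  rw [← card_quot_NF, ← card_bad n hn, card_good n hn,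
    ← Nat.card_congr (Equiv.sumCompl (BadCls n)), Nat.card_sum]
  ring

theorem sum_half_odd (q : ℕ) : (∑ L ∈ Finset.range (2*q), 2 ^ (L/2)) + 2 = 2 ^ (q+1) := by
  induction q with
  | zero => simp
  | succ q ih =>
    rw [show 2*(q+1) = 2*q+1+1 by ring, Finset.sum_range_succ, Finset.sum_range_succ,
      show (2*q+1)/2 = q by omega, show (2*q)/2 = q by omega]
    have : 2^(q+1+1) = 2^(q+1) + 2^q + 2^q := by ring
    omega

theorem sum_half_even (q : ℕ) : (∑ L ∈ Finset.range (2*q+1), 2 ^ (L/2)) + 2 = 3 * 2 ^ q := by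
  have := sum_half_odd q
  rw [Finset.sum_range_succ, show (2*q)/2 = q by omega]
  have : 2^(q+1) = 2 * 2^q := by ring
  omega

theorem sum_div_eq (n : ℕ) :
    ((∑ d ∈ n.divisors, d.totient * 2 ^ (n / d) : ℕ) : ℚ)
      = 2 * ∑ d ∈ n.divisors, (Nat.totient d : ℚ) * 2 ^ (n / d - 1) := by
  push_cast
  rw [Finset.mul_sum]
  apply Finset.sum_congr rfl
  intro d hd
  have h1 := Nat.divisor_le hd
  have h2 := Nat.pos_of_mem_divisors hd
  have : 0 < n / d := Nat.div_pos h1 h2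
  obtain ⟨k, hk⟩ : ∃ k, n / d = k + 1 := ⟨n/d - 1, by omega⟩
  rw [hk, Nat.add_sub_cancel, pow_succ]; ring

theorem refl_odd_rat (n m : ℕ) [NeZero n] (h : n = 2*m+1) :
    ((∑ c : ZMod n, 2 ^ ((n + Nat.card {i : ZMod n // -i - c = i}) / 2) : ℕ) : ℚ)
      = n * 2^(m+1) := by
  subst h
  rw [sum_fix_refl_odd]
  push_cast; ring

theorem refl_even_rat (n m : ℕ) [NeZero n] (h : n = 2*m) :
    ((∑ c : ZMod n, 2 ^ ((n + Nat.card {i : ZMod n // -i - c = i}) / 2) : ℕ) : ℚ)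
      = n * (3 * 2^m / 2) := by
  subst h
  rw [sum_fix_refl_even m (by have := NeZero.ne (2*m); omega)]
  push_cast; ring

/-- For `n ≥ 3`, the number of orbits of the dihedral group `D_n` on good binary
`n`-tuples. -/
theorem dihedral_orbits (n : ℕ) (hn : 3 ≤ n) :
    (Nat.card (Quot (DihedralRel n)) : ℚ)
      = (∑ d ∈ n.divisors, (Nat.totient d : ℚ) * 2 ^ (n / d - 1)) / n
        + 2 ^ ((n - 3) / 2)
        - if n % 4 = 0 ∨ n % 4 = 1 then 3 * 2 ^ ((n - 4) / 4)
          else 2 ^ ((n + 2) / 4) := by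
  have : NeZero n := ⟨by omega⟩
  have hT := card_total n hn
  have hA := card_all n
  have hA' := congrArg (Nat.cast : ℕ → ℚ) hA
  have hT' := congrArg (Nat.cast : ℕ → ℚ) hT
  rw [Nat.cast_add, sum_div_eq] at hA'
  have hn0 : (n : ℚ) ≠ 0 := by exact_mod_cast NeZero.ne n
  generalize (∑ d ∈ n.divisors, (Nat.totient d : ℚ) * 2 ^ (n / d - 1)) = D at *
  generalize Nat.card (Quot (DihedralRel n)) = G at *
  generalize Nat.card (Quotient (dihSetoid n)) = A at *
  -- reduce to the reflection part
  have main : ∀ (Rn Bn : ℚ),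
      ((∑ c : ZMod n, 2 ^ ((n + Nat.card {i : ZMod n // -i - c = i}) / 2) : ℕ) : ℚ) = n * Rn →
      ((∑ L ∈ Finset.range (n/2+1), 2 ^ (L/2) : ℕ) : ℚ) + 2 = Bn →
      (G : ℚ) = D / n + (Rn - 2 ^ (n/2) - Bn) / 2 := by
    intro Rn Bn h1 h2
    rw [h1] at hA'
    push_cast at hA' hT' h2
    have h3 : (A : ℚ) * 2 = 2 * (D / n) + Rn := by
      field_simp
      linear_combination hA'
    linear_combination (-1/2) * hT' + (1/2) * h3 - (1/2) * h2
  obtain ⟨q, hq⟩ : ∃ q, n = 4*q ∨ n = 4*q+1 ∨ n = 4*q+2 ∨ n = 4*q+3 := ⟨n/4, by omega⟩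
  have hso := congrArg (Nat.cast : ℕ → ℚ) (sum_half_odd (q+1))
  have hse := congrArg (Nat.cast : ℕ → ℚ) (sum_half_even q)
  rw [Nat.cast_add] at hso hse
  rcases hq with hq | hq | hq | hq
  · obtain ⟨p, rfl⟩ : ∃ p, q = p + 1 := ⟨q - 1, by omega⟩
    rw [main _ ((3 * 2 ^ (p+1) : ℕ) : ℚ) (refl_even_rat n (2*(p+1)) (by omega))
      (by rw [show n/2 = 2*(p+1) by omega]; exact hse),
      if_pos (by omega), show n/2 = 2*p+2 by omega, show (n-3)/2 = 2*p by omega,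
      show (n-4)/4 = p by omega]
    push_cast; ring
  · obtain ⟨p, rfl⟩ : ∃ p, q = p + 1 := ⟨q - 1, by omega⟩
    rw [main _ ((3 * 2 ^ (p+1) : ℕ) : ℚ) (refl_odd_rat n (2*(p+1)) (by omega))
      (by rw [show n/2 = 2*(p+1) by omega]; exact hse),
      if_pos (by omega), show n/2 = 2*p+2 by omega, show (n-3)/2 = 2*p+1 by omega,
      show (n-4)/4 = p by omega]
    push_cast; ring
  · obtain ⟨p, rfl⟩ : ∃ p, q = p + 1 := ⟨q - 1, by omega⟩
    rw [main _ ((2 ^ (p+1+1+1) : ℕ) : ℚ) (refl_even_rat n (2*(p+1)+1) (by omega))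
      (by rw [show n/2+1 = 2*(p+1+1) by omega]; exact hso),
      if_neg (by omega), show n/2 = 2*p+3 by omega, show (n-3)/2 = 2*p+1 by omega,
      show (n+2)/4 = p+2 by omega]
    push_cast; ring
  · rw [main _ ((2 ^ (q+1+1) : ℕ) : ℚ) (refl_odd_rat n (2*q+1) (by omega))
      (by rw [show n/2+1 = 2*(q+1) by omega]; exact hso),
      if_neg (by omega), show n/2 = 2*q+1 by omega, show (n-3)/2 = 2*q by omega,
      show (n+2)/4 = q+1 by omega]
    push_cast; ring
end

section
/- The number p_n of inequivalent integer polygons with perimeter n satisfies p_n ~ 2^{n-1}/n as n → ∞, i.e., lim_{n→∞} p_n · n / 2^{n-1} = 1. -/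
open Filter

/-- Integer polygons of perimeter `n`: tuples (here lists) of at least 3 positive
integer side lengths, each strictly less than `n/2`, summing to `n`. -/
def IntPolygon (n : ℕ) : Type :=
  {l : List ℕ // 3 ≤ l.length ∧ (∀ x ∈ l, 0 < x ∧ 2 * x < n) ∧ l.sum = n}

/-- Two polygons are equivalent iff one side-list is a cyclic rotation of the other,
or of its reversal. -/
def PolyRel (n : ℕ) (a b : IntPolygon n) : Prop :=
  ∃ k : ℕ, b.1 = a.1.rotate k ∨ b.1 = a.1.reverse.rotate k

/-- The number of inequivalent integer polygons with perimeter `n`. -/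
noncomputable def polyCount (n : ℕ) : ℕ := Nat.card (Quot (PolyRel n))

def incHead : List ℕ → List ℕ
  | [] => []
  | x :: l => (x + 1) :: l

def cT : ℕ → ℕ → Finset (List ℕ)
  | 0, 0 => {[]}
  | 0, _ + 1 => ∅
  | _ + 1, 0 => ∅
  | n + 1, m + 1 => (cT n m).image (List.cons 1) ∪ (cT n (m + 1)).image incHead

lemma mem_cT (n m : ℕ) (l : List ℕ) :
    l ∈ cT n m ↔ l.length = m ∧ (∀ x ∈ l, 0 < x) ∧ l.sum = n := by
  induction n generalizing m l with
  | zero =>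
    cases m with
    | zero => cases l <;> simp [cT]
    | succ m =>
      cases l with
      | nil => simp [cT]
      | cons x l => simp [cT]; intros; omega
  | succ n ih =>
    cases m with
    | zero => cases l <;> simp [cT]
    | succ m =>
      simp only [cT, Finset.mem_union, Finset.mem_image, ih]
      constructor
      · rintro (⟨a, ⟨h1, h2, h3⟩, rfl⟩ | ⟨a, ⟨h1, h2, h3⟩, rfl⟩)
        · refine ⟨by simp [h1], ?_, by simp [h3]; omega⟩
          intro x hx
          rcases List.mem_cons.1 hx with rfl | hx
          · omega
          · exact h2 x hx
        · cases a with
          | nil => simp at h1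
          | cons y a =>
            refine ⟨by simpa [incHead] using h1, ?_, by simp [incHead] at *; omega⟩
            intro x hx
            rcases List.mem_cons.1 hx with rfl | hx
            · omega
            · exact h2 x (List.mem_cons_of_mem _ hx)
      · rintro ⟨h1, h2, h3⟩
        cases l with
        | nil => simp at h1
        | cons y a =>
          have hy := h2 y (by simp)
          by_cases hy1 : y = 1
          · left
            subst hy1
            refine ⟨a, ⟨by simpa using h1, fun x hx => h2 x (List.mem_cons_of_mem _ hx), ?_⟩, rfl⟩
            simp at h3; omega
          · right
            refine ⟨(y - 1) :: a, ⟨by simpa using h1, ?_, ?_⟩, ?_⟩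
            · intro x hx
              rcases List.mem_cons.1 hx with rfl | hx
              · omega
              · exact h2 x (List.mem_cons_of_mem _ hx)
            · simp at h3 ⊢; omega
            · simp [incHead]; omega

lemma incHead_inj : Function.Injective incHead := by
  intro a b h
  cases a <;> cases b <;> simp_all [incHead]

lemma card_cT_succ (n m : ℕ) : (cT (n + 1) (m + 1)).card = n.choose m := by
  have key : ∀ n m, (cT (n + 1) (m + 1)).card = (cT n m).card + (cT n (m + 1)).card := by
    intro n m
    rw [cT, Finset.card_union_of_disjoint, Finset.card_image_of_injective,
      Finset.card_image_of_injective _ incHead_inj]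
    · exact List.cons_injective
    · rw [Finset.disjoint_left]
      intro l h1 h2
      obtain ⟨a, ha, rfl⟩ := Finset.mem_image.1 h1
      obtain ⟨b, hb, h⟩ := Finset.mem_image.1 h2
      rw [mem_cT] at hb
      cases b with
      | nil => simp at hb
      | cons y b =>
        have := hb.2.1 y (by simp)
        simp [incHead] at h
        omega
  induction n generalizing m with
  | zero => rw [key]; cases m <;> simp [cT]
  | succ n ih =>
    rw [key, ih]
    cases m with
    | zero => simp [cT]
    | succ m => rw [ih, Nat.choose_succ_succ]

/-- all compositions of n -/
def cL (n : ℕ) : Finset (List ℕ) := (Finset.range (n + 1)).biUnion (cT n)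

lemma len_le_sum (l : List ℕ) (h : ∀ x ∈ l, 0 < x) : l.length ≤ l.sum := by
  induction l with
  | nil => simp
  | cons x l ih =>
    have := ih (fun y hy => h y (List.mem_cons_of_mem _ hy))
    have := h x (by simp)
    simp; omega

lemma mem_cL (n : ℕ) (l : List ℕ) : l ∈ cL n ↔ (∀ x ∈ l, 0 < x) ∧ l.sum = n := by
  simp only [cL, Finset.mem_biUnion, mem_cT, Finset.mem_range]
  constructor
  · rintro ⟨m, _, _, h⟩; exact h
  · intro h
    refine ⟨l.length, ?_, rfl, h⟩
    have := len_le_sum l h.1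
    omega

lemma sum_cL (n : ℕ) (f : ℕ → ℝ) :
    ∑ l ∈ cL (n + 1), f l.length = ∑ m ∈ Finset.range (n + 1), n.choose m * f (m + 1) := by
  rw [cL, Finset.sum_biUnion]
  · rw [Finset.sum_range_succ']
    simp only [cT, Finset.sum_empty, add_zero]
    apply Finset.sum_congr rfl
    intro m _
    rw [← card_cT_succ, ← nsmul_eq_mul, ← Finset.sum_const]
    apply Finset.sum_congr rfl
    intro l hl
    rw [((mem_cT (n+1) (m+1) l).1 hl).1]
  · intro i _ j _ hij
    rw [Function.onFun, Finset.disjoint_left]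
    intro l h1 h2
    rw [mem_cT] at h1 h2
    omega

lemma card_cL (n : ℕ) : (cL n).card ≤ 2 ^ n := by
  cases n with
  | zero => simp [cL, cT]
  | succ n =>
    have := sum_cL n (fun _ => 1)
    simp only [Finset.sum_const, nsmul_eq_mul, mul_one] at this
    have h2 : (cL (n+1)).card = ∑ m ∈ Finset.range (n + 1), n.choose m := by exact_mod_cast this
    rw [h2, Nat.sum_range_choose, pow_succ]
    omega

lemma sum_inv_cL (n : ℕ) : ∑ l ∈ cL (n + 1), (1 : ℝ) / (2 * l.length) =
    (2 ^ (n + 1) - 1) / (2 * (n + 1)) := by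
  rw [sum_cL n (fun k => 1 / (2 * (k : ℝ)))]
  have h : ∑ m ∈ Finset.range (n + 2), ((n+1).choose m : ℝ) = 2 ^ (n + 1) := by
    exact_mod_cast Nat.sum_range_choose (n + 1)
  rw [Finset.sum_range_succ'] at h
  simp only [Nat.choose_zero_right, Nat.cast_one] at h
  rw [← h, add_sub_cancel_right, Finset.sum_div]
  apply Finset.sum_congr rfl
  intro m _
  have h3 : ((n : ℝ) + 1) * n.choose m = (n + 1).choose (m + 1) * (m + 1) := by
    exact_mod_cast Nat.add_one_mul_choose_eq n m
  push_cast
  field_simp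
  linarith

/-- all compositions of numbers up to n/2 -/
def cA (n : ℕ) : Finset (List ℕ) := (Finset.range (n / 2 + 1)).biUnion cL

lemma mem_cA (n : ℕ) (l : List ℕ) : l ∈ cA n ↔ (∀ x ∈ l, 0 < x) ∧ 2 * l.sum ≤ n := by
  simp only [cA, Finset.mem_biUnion, mem_cL, Finset.mem_range]
  constructor
  · rintro ⟨m, h, h1, h2⟩; exact ⟨h1, by omega⟩
  · intro h
    exact ⟨l.sum, by omega, h.1, rfl⟩

lemma card_cA (n : ℕ) : (cA n).card ≤ (n + 1) * 2 ^ (n / 2) := by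
  calc (cA n).card ≤ (Finset.range (n / 2 + 1)).card * 2 ^ (n / 2) := by
        apply Finset.card_biUnion_le_card_mul
        intro s hs
        refine (card_cL s).trans (Nat.pow_le_pow_right (by norm_num) ?_)
        simp at hs; omega
    _ ≤ _ := by
        rw [Finset.card_range]
        gcongr
        omega

def opt (c : ℕ) : List ℕ := if c = 0 then [] else [c]

lemma pal_split (p : List ℕ) (hp : p.Palindrome) (hpos : ∀ x ∈ p, 0 < x) :
    ∃ w c, p = w ++ opt c ++ w.reverse := by
  induction hp with
  | nil => exact ⟨[], 0, by simp [opt]⟩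
  | singleton x =>
    have := hpos x (by simp)
    exact ⟨[], x, by simp [opt]; omega⟩
  | cons_concat x h ih =>
    obtain ⟨w, c, rfl⟩ := ih (fun y hy => hpos y (by simp at hy ⊢; tauto))
    exact ⟨x :: w, c, by simp⟩

def decPal (q : List ℕ × ℕ × ℕ × ℕ) : List ℕ :=
  let u := q.1.take q.2.1
  let v := q.1.drop q.2.1
  (u ++ opt q.2.2.1 ++ u.reverse) ++ (v ++ opt q.2.2.2 ++ v.reverse)

def decPer (q : List ℕ × ℕ × ℕ × ℕ) : List ℕ :=
  ((List.replicate q.2.1 q.1).flatten).take q.2.1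

def decBig (q : List ℕ × ℕ × ℕ × ℕ) : List ℕ :=
  q.1.take q.2.1 ++ [q.2.2.1] ++ q.1.drop q.2.1

def codes (n : ℕ) : Finset (List ℕ × ℕ × ℕ × ℕ) :=
  cA n ×ˢ Finset.range (n + 1) ×ˢ Finset.range (n + 1) ×ˢ Finset.range (n + 1)

lemma card_codes (n : ℕ) : (codes n).card ≤ (n + 1) ^ 4 * 2 ^ (n / 2) := by
  simp only [codes, Finset.card_product, Finset.card_range]
  calc _ ≤ ((n + 1) * 2 ^ (n / 2)) * ((n + 1) * ((n + 1) * (n + 1))) :=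
        Nat.mul_le_mul_right _ (card_cA n)
    _ = _ := by ring

def badBig (n : ℕ) := (codes n).image decBig
def badSym (n : ℕ) := (codes n).image decPal ∪ (codes n).image decPer

lemma opt_sum (c : ℕ) : (opt c).sum = c := by
  unfold opt; split_ifs <;> simp_all

lemma mem_badBig (n : ℕ) (l : List ℕ) (hl : l ∈ cL n) (x : ℕ) (hx : x ∈ l) (hn : n ≤ 2 * x) :
    l ∈ badBig n := by
  obtain ⟨u, v, rfl⟩ := List.append_of_mem hx
  rw [mem_cL] at hl
  obtain ⟨h1, h2⟩ := hl
  have hu : ∀ y ∈ u, 0 < y := fun y hy => h1 y (by simp [hy])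
  have := len_le_sum u hu
  simp at h2
  refine Finset.mem_image.2 ⟨(u ++ v, u.length, x, 0), ?_, ?_⟩
  · simp only [codes, Finset.mem_product, mem_cA, Finset.mem_range]
    refine ⟨⟨fun y hy => h1 y ?_, ?_⟩, ?_, ?_, ?_⟩
    · simp at hy ⊢; tauto
    · simp; omega
    all_goals omega
  · simp [decBig]

lemma mem_badPal (n : ℕ) (l : List ℕ) (hl : l ∈ cL n) (k : ℕ) (hk : l.reverse.rotate k = l) :
    l ∈ badSym n := by
  rw [mem_cL] at hl
  obtain ⟨h1, h2⟩ := hl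
  wlog hkl : k ≤ l.length generalizing k
  · by_cases h0 : l.length = 0
    · exact this 0 (by simp [List.length_eq_zero_iff.1 h0]) (by omega)
    · refine this (k % l.length) ?_ (Nat.mod_lt _ (by omega)).le
      rw [← List.length_reverse, List.rotate_mod, hk]
  rw [List.rotate_eq_drop_append_take (by simpa using hkl)] at hk
  obtain ⟨a, b, hab, ha⟩ : ∃ a b, l.reverse = a ++ b ∧ b ++ a = l :=
    ⟨_, _, (List.take_append_drop k l.reverse).symm, hk⟩
  subst ha
  rw [List.reverse_append] at hab
  obtain ⟨e1, e2⟩ := List.append_inj hab (by simp)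
  obtain ⟨u, c, rfl⟩ := pal_split b (List.Palindrome.of_reverse_eq e2)
    (fun x hx => h1 x (by simp only [List.mem_append] at hx ⊢; tauto))
  obtain ⟨v, d, rfl⟩ := pal_split a (List.Palindrome.of_reverse_eq e1)
    (fun x hx => h1 x (by simp only [List.mem_append] at hx ⊢; tauto))
  have hu : ∀ y ∈ u, 0 < y := fun y hy => h1 y (by simp [hy])
  have := len_le_sum u hu
  simp [opt_sum] at h2
  refine Finset.mem_union_left _ (Finset.mem_image.2 ⟨(u ++ v, u.length, c, d), ?_, ?_⟩)
  · simp only [codes, Finset.mem_product, mem_cA, Finset.mem_range]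
    refine ⟨⟨fun y hy => h1 y ?_, ?_⟩, ?_, ?_, ?_⟩
    · simp at hy ⊢; tauto
    · simp; omega
    all_goals omega
  · simp [decPal]

lemma per_aux (u v : List ℕ) (hu : u ≠ []) (h : u ++ v = v ++ u) (m : ℕ)
    (hm : (u ++ v).length = m) : u ++ v = ((List.replicate m u).flatten).take m := by
  have key : ∀ j, (u ++ v) <+: (List.replicate j u).flatten ++ (u ++ v) := by
    intro j
    induction j with
    | zero => simp
    | succ j ih =>
      have h1 : (u ++ v) <+: u ++ (u ++ v) := ⟨u, by rw [List.append_assoc, ← h]⟩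
      refine h1.trans ?_
      rw [List.replicate_succ, List.flatten_cons, List.append_assoc]
      exact (List.prefix_append_right_inj u).2 ih
  have h2 : (u ++ v) <+: (List.replicate m u).flatten := by
    refine List.prefix_of_prefix_length_le (key m) (List.prefix_append _ _) ?_
    rw [hm]
    have : 0 < u.length := List.length_pos_iff.2 hu
    simp
    nlinarith
  have := List.prefix_iff_eq_take.1 h2
  rw [hm] at this
  exact this

lemma mem_badPer (n : ℕ) (l : List ℕ) (hl : l ∈ cL n) (k : ℕ) (hk0 : 0 < k)
    (hkl : k < l.length) (hk : l.rotate k = l) : l ∈ badSym n := by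
  rw [mem_cL] at hl
  obtain ⟨h1, h2⟩ := hl
  rw [List.rotate_eq_drop_append_take hkl.le] at hk
  have main : ∀ u v : List ℕ, u ≠ [] → u ++ v = v ++ u → u ++ v = l → 2 * u.sum ≤ n →
      l ∈ badSym n := by
    intro u v hu h e hs
    have := len_le_sum l h1
    refine Finset.mem_union_right _ (Finset.mem_image.2 ⟨(u, l.length, 0, 0), ?_, ?_⟩)
    · simp only [codes, Finset.mem_product, mem_cA, Finset.mem_range]
      refine ⟨⟨fun y hy => h1 y ?_, hs⟩, ?_, ?_, ?_⟩
      · rw [← e]; simp [hy]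
      all_goals omega
    · rw [decPer, ← per_aux u v hu h _ (by rw [e]), e]
  have e := List.take_append_drop k l
  have hsum : (l.take k).sum + (l.drop k).sum = n := by rw [← List.sum_append, e, h2]
  by_cases hc : 2 * (l.take k).sum ≤ n
  · refine main (l.take k) (l.drop k) ?_ (by rw [hk, e]) e hc
    rw [← List.length_pos_iff]; simp; omega
  · refine main (l.drop k) (l.take k) ?_ (by rw [hk, e]) hk (by omega)
    rw [← List.length_pos_iff]; simp; omega

def orb (l : List ℕ) : Finset (List ℕ) :=
  (Finset.range l.length).image l.rotate ∪ (Finset.range l.length).image l.reverse.rotate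

lemma mem_orb (l l' : List ℕ) (hl : l ≠ []) :
    l' ∈ orb l ↔ ∃ k : ℕ, l' = l.rotate k ∨ l' = l.reverse.rotate k := by
  have h0 : 0 < l.length := List.length_pos_iff.2 hl
  simp only [orb, Finset.mem_union, Finset.mem_image, Finset.mem_range]
  constructor
  · rintro (⟨k, _, h⟩ | ⟨k, _, h⟩)
    · exact ⟨k, Or.inl h.symm⟩
    · exact ⟨k, Or.inr h.symm⟩
  · rintro ⟨k, rfl | rfl⟩
    · exact Or.inl ⟨k % l.length, Nat.mod_lt _ h0, List.rotate_mod _ _⟩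
    · refine Or.inr ⟨k % l.length, Nat.mod_lt _ h0, ?_⟩
      have := List.rotate_mod l.reverse k
      rwa [List.length_reverse] at this

lemma card_orb_le (l : List ℕ) : (orb l).card ≤ 2 * l.length := by
  refine (Finset.card_union_le _ _).trans ?_
  have h1 := Finset.card_image_le (s := Finset.range l.length) (f := l.rotate)
  have h2 := Finset.card_image_le (s := Finset.range l.length) (f := l.reverse.rotate)
  rw [Finset.card_range] at h1 h2
  omega

lemma rotate_inj_aux (n : ℕ) (l : List ℕ) (hl : l ∈ cL n) (hb : l ∉ badSym n) (i j : ℕ)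
    (hij : i < j) (hj : j < l.length) (h : l.rotate i = l.rotate j) : False := by
  apply hb
  apply mem_badPer n l hl (j - i) (by omega) (by omega)
  have : l.rotate j = (l.rotate (j - i)).rotate i := by
    rw [List.rotate_rotate]; congr 1; omega
  rw [this] at h
  exact (List.rotate_injective i h).symm

lemma rotate_inj (n : ℕ) (l : List ℕ) (hl : l ∈ cL n) (hb : l ∉ badSym n) (i j : ℕ)
    (hi : i < l.length) (hj : j < l.length) (h : l.rotate i = l.rotate j) : i = j := by
  rcases lt_trichotomy i j with hij | hij | hij
  · exact (rotate_inj_aux n l hl hb i j hij hj h).elim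
  · exact hij
  · exact (rotate_inj_aux n l hl hb j i hij hi h.symm).elim

lemma card_orb_eq (n : ℕ) (l : List ℕ) (hl : l ∈ cL n) (hb : l ∉ badSym n) :
    (orb l).card = 2 * l.length := by
  rw [orb, Finset.card_union_of_disjoint, Finset.card_image_of_injOn,
    Finset.card_image_of_injOn, Finset.card_range]
  · omega
  · intro i hi j hj h
    simp only [Finset.coe_range, Set.mem_Iio] at hi hj
    have h' := congrArg List.reverse h
    simp only [List.reverse_rotate, List.reverse_reverse, List.length_reverse] at h'
    rw [Nat.mod_eq_of_lt hi, Nat.mod_eq_of_lt hj] at h'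
    have e : ∀ i, i < l.length → l.rotate (l.length - i) = l.rotate ((l.length - i) % l.length) :=
      fun i _ => (List.rotate_mod _ _).symm
    rw [e i hi, e j hj] at h'
    have h3 := rotate_inj n l hl hb _ _ (Nat.mod_lt _ (by omega)) (Nat.mod_lt _ (by omega)) h'
    have e2 : ∀ i, i < l.length → (l.length - i) % l.length = if i = 0 then 0 else l.length - i := by
      intro i hi
      split_ifs with h0
      · simp [h0]
      · exact Nat.mod_eq_of_lt (by omega)
    rw [e2 i hi, e2 j hj] at h3
    split_ifs at h3 <;> omega
  · intro i hi j hj h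
    simp only [Finset.coe_range, Set.mem_Iio] at hi hj
    exact rotate_inj n l hl hb i j hi hj h
  · rw [Finset.disjoint_left]
    intro x h1 h2
    obtain ⟨i, hi, rfl⟩ := Finset.mem_image.1 h1
    obtain ⟨j, hj, h⟩ := Finset.mem_image.1 h2
    have hr : l.reverse ~r l := List.IsRotated.trans ⟨j, h⟩ (List.IsRotated.symm ⟨i, rfl⟩)
    obtain ⟨k, hk⟩ := hr
    exact hb (mem_badPal n l hl k hk)

lemma polyRel_iff (n : ℕ) (a b : IntPolygon n) :
    PolyRel n a b ↔ (a.1 ~r b.1 ∨ a.1.reverse ~r b.1) := by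
  constructor
  · rintro ⟨k, h | h⟩
    · exact Or.inl ⟨k, h.symm⟩
    · exact Or.inr ⟨k, h.symm⟩
  · rintro (⟨k, h⟩ | ⟨k, h⟩)
    · exact ⟨k, Or.inl h.symm⟩
    · exact ⟨k, Or.inr h.symm⟩

lemma polyRel_equiv (n : ℕ) : Equivalence (PolyRel n) where
  refl a := ⟨0, by simp⟩
  symm := by
    intro a b h
    rw [polyRel_iff] at *
    rcases h with h | h
    · exact Or.inl h.symm
    · right
      have := h.reverse
      rw [List.reverse_reverse] at this
      exact this.symm
  trans := by
    intro a b c h1 h2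
    rw [polyRel_iff] at *
    rcases h1 with h1 | h1 <;> rcases h2 with h2 | h2
    · exact Or.inl (h1.trans h2)
    · exact Or.inr (h1.reverse.trans h2)
    · exact Or.inr (h1.trans h2)
    · left
      have := h1.reverse
      rw [List.reverse_reverse] at this
      exact this.trans h2

def polyF (n : ℕ) : Finset (List ℕ) :=
  (cL n).filter (fun l => 3 ≤ l.length ∧ ∀ x ∈ l, 2 * x < n)

lemma mem_polyF (n : ℕ) (l : List ℕ) :
    l ∈ polyF n ↔ 3 ≤ l.length ∧ (∀ x ∈ l, 0 < x ∧ 2 * x < n) ∧ l.sum = n := by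
  rw [polyF, Finset.mem_filter, mem_cL]
  constructor
  · rintro ⟨⟨h1, h2⟩, h3, h4⟩
    exact ⟨h3, fun x hx => ⟨h1 x hx, h4 x hx⟩, h2⟩
  · rintro ⟨h1, h2, h3⟩
    exact ⟨⟨fun x hx => (h2 x hx).1, h3⟩, h1, fun x hx => (h2 x hx).2⟩

lemma polyCount_eq (n : ℕ) : (polyCount n : ℝ) = ∑ l ∈ polyF n, (1 : ℝ) / (orb l).card := by
  classical
  have : Fintype (IntPolygon n) := Fintype.subtype (polyF n) (mem_polyF n)
  have : Finite (Quot (PolyRel n)) := Finite.of_surjective (Quot.mk _) Quot.mk_surjective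
  have : Fintype (Quot (PolyRel n)) := Fintype.ofFinite _
  have hsum : ∑ l ∈ polyF n, (1 : ℝ) / (orb l).card =
      ∑ a : IntPolygon n, (1 : ℝ) / (orb a.1).card :=
    Finset.sum_subtype (polyF n) (mem_polyF n) _
  have hfib : ∀ a : IntPolygon n, (Finset.univ.filter
      (fun b : IntPolygon n => Quot.mk (PolyRel n) b = Quot.mk (PolyRel n) a)).card
      = (orb a.1).card := by
    intro a
    have hne : a.1 ≠ [] := by
      have := a.2.1
      intro h
      rw [h] at this
      simp at this
    apply Finset.card_bij (fun b _ => b.1)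
    · intro b hb
      rw [Finset.mem_filter] at hb
      rw [mem_orb _ _ hne]
      exact (polyRel_equiv n).quot_mk_eq_iff a b |>.1 hb.2.symm
    · intro b _ c _ h
      exact Subtype.ext h
    · intro l hl
      rw [mem_orb _ _ hne] at hl
      have hp : l.Perm a.1 := by
        obtain ⟨k, rfl | rfl⟩ := hl
        · exact List.rotate_perm _ _
        · exact (List.rotate_perm _ _).trans (List.reverse_perm _)
      refine ⟨⟨l, ?_, ?_, ?_⟩, ?_, rfl⟩
      · rw [hp.length_eq]; exact a.2.1
      · intro x hx
        exact a.2.2.1 x (hp.mem_iff.1 hx)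
      · rw [hp.sum_eq]; exact a.2.2.2
      · refine Finset.mem_filter.2 ⟨Finset.mem_univ _, Eq.symm ?_⟩
        exact Quot.sound hl
  rw [hsum, ← Finset.sum_fiberwise Finset.univ (fun a => Quot.mk (PolyRel n) a)]
  have h1 : ∀ q : Quot (PolyRel n), ∑ a : IntPolygon n with Quot.mk (PolyRel n) a = q,
      (1 : ℝ) / (orb a.1).card = 1 := by
    intro q
    obtain ⟨a, rfl⟩ := Quot.mk_surjective q
    have : ∀ b ∈ Finset.univ.filter
      (fun b : IntPolygon n => Quot.mk (PolyRel n) b = Quot.mk (PolyRel n) a),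
      (1 : ℝ) / (orb b.1).card = 1 / (orb a.1).card := by
      intro b hb
      rw [← hfib, ← hfib, (Finset.mem_filter.1 hb).2]
    rw [Finset.sum_congr rfl this, Finset.sum_const, hfib, nsmul_eq_mul]
    have : (orb a.1).card ≠ 0 := by
      rw [← hfib]
      exact Finset.card_ne_zero_of_mem (a := a) (by simp)
    field_simp
  rw [Finset.sum_congr rfl (fun q _ => h1 q)]
  simp [polyCount, Nat.card_eq_fintype_card]

lemma non_poly (n : ℕ) (l : List ℕ) (hl : l ∈ cL (n + 1)) (h : l ∉ polyF (n + 1)) :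
    l ∈ badBig (n + 1) := by
  by_contra hb
  have hx : ∀ x ∈ l, 2 * x < n + 1 := by
    intro x hx
    by_contra hc
    exact hb (mem_badBig _ l hl x hx (by omega))
  apply h
  rw [polyF, Finset.mem_filter]
  refine ⟨hl, ?_, hx⟩
  rw [mem_cL] at hl
  match l, hl, hx with
  | [], hl, _ => simp at hl
  | [x], hl, hx => 
    have := hx x (by simp)
    simp at hl; omega
  | [x, y], hl, hx =>
    have := hx x (by simp)
    have := hx y (by simp)
    simp at hl; omega
  | x :: y :: z :: l, _, _ => simp

lemma main_bound (n : ℕ) :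
    |(polyCount (n + 1) : ℝ) - (2 ^ (n + 1) - 1) / (2 * (n + 1))| ≤
      3 * ((n + 2) ^ 4 * 2 ^ ((n + 1) / 2)) := by
  have hsub : polyF (n + 1) ⊆ cL (n + 1) := Finset.filter_subset _ _
  have hc : ((codes (n + 1)).card : ℝ) ≤ (n + 2) ^ 4 * 2 ^ ((n + 1) / 2) := by
    exact_mod_cast card_codes (n + 1)
  have hB : ((badBig (n + 1)).card : ℝ) ≤ (codes (n + 1)).card := by
    exact_mod_cast Finset.card_image_le
  have hS : ((badSym (n + 1)).card : ℝ) ≤ 2 * (codes (n + 1)).card := by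
    have h1 := Finset.card_image_le (s := codes (n + 1)) (f := decPal)
    have h2 := Finset.card_image_le (s := codes (n + 1)) (f := decPer)
    have h3 := Finset.card_union_le ((codes (n + 1)).image decPal) ((codes (n + 1)).image decPer)
    have : (badSym (n + 1)).card ≤ 2 * (codes (n + 1)).card := by
      rw [badSym]; omega
    exact_mod_cast this
  have hpoint : ∀ l : List ℕ, (1 : ℝ) / (2 * l.length) ≤ 1 := by
    intro l
    rcases Nat.eq_zero_or_pos l.length with h | h
    · simp [h]
    · have : (1 : ℝ) ≤ l.length := by exact_mod_cast h
      rw [div_le_one (by positivity)]; linarith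
  -- splitting
  have hsplit := Finset.sum_sdiff (f := fun l : List ℕ => (1 : ℝ) / (2 * l.length)) hsub
  rw [sum_inv_cL] at hsplit
  have e1 : ∑ l ∈ cL (n + 1) \ polyF (n + 1), (1 : ℝ) / (2 * l.length) ≤ (badBig (n + 1)).card := by
    calc _ ≤ ∑ l ∈ cL (n + 1) \ polyF (n + 1), (1 : ℝ) := Finset.sum_le_sum fun l _ => hpoint l
      _ = ((cL (n + 1) \ polyF (n + 1)).card : ℝ) := by simp
      _ ≤ _ := by
        exact_mod_cast Finset.card_le_card fun l hl =>
          non_poly n l (Finset.mem_sdiff.1 hl).1 (Finset.mem_sdiff.1 hl).2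
  have e0 : 0 ≤ ∑ l ∈ cL (n + 1) \ polyF (n + 1), (1 : ℝ) / (2 * l.length) :=
    Finset.sum_nonneg fun l _ => by positivity
  have hpos : ∀ l ∈ polyF (n + 1), 0 < (orb l).card := by
    intro l hl
    rw [mem_polyF] at hl
    refine Finset.card_pos.2 ⟨l, (mem_orb l l ?_).2 ⟨0, by simp⟩⟩
    rw [← List.length_pos_iff]; omega
  have e2 : ∑ l ∈ polyF (n + 1), (1 : ℝ) / (2 * l.length) ≤ polyCount (n + 1) := by
    rw [polyCount_eq]
    apply Finset.sum_le_sum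
    intro l hl
    have h1 : (0 : ℝ) < (orb l).card := by exact_mod_cast hpos l hl
    have h2 : ((orb l).card : ℝ) ≤ 2 * l.length := by exact_mod_cast card_orb_le l
    exact one_div_le_one_div_of_le h1 h2
  have e3 : (polyCount (n + 1) : ℝ) ≤ ∑ l ∈ polyF (n + 1), (1 : ℝ) / (2 * l.length) +
      (badSym (n + 1)).card := by
    rw [polyCount_eq]
    calc _ ≤ ∑ l ∈ polyF (n + 1), ((1 : ℝ) / (2 * l.length) +
          if l ∈ badSym (n + 1) then 1 else 0) := by
          apply Finset.sum_le_sum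
          intro l hl
          have h1 : (1 : ℝ) ≤ (orb l).card := by exact_mod_cast hpos l hl
          split_ifs with hb
          · have : (1 : ℝ) / (orb l).card ≤ 1 := by
              rw [div_le_one (by linarith)]; exact h1
            have : (0 : ℝ) ≤ 1 / (2 * l.length) := by positivity
            linarith
          · rw [card_orb_eq _ l (hsub hl) hb]
            push_cast
            linarith
      _ ≤ _ := by
          rw [Finset.sum_add_distrib]
          gcongr
          rw [← Finset.sum_filter, Finset.sum_const, nsmul_eq_mul, mul_one]
          exact_mod_cast Finset.card_le_card fun l hl => (Finset.mem_filter.1 hl).2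
  rw [abs_le]
  constructor <;> linarith

/-- The number of inequivalent integer polygons of perimeter `n` is asymptotic to
`2^{n-1}/n`. -/
theorem polyCount_asymptotic :
    Tendsto (fun n : ℕ => (polyCount n : ℝ) * n / 2 ^ (n - 1)) atTop (nhds 1) := by
  rw [← tendsto_add_atTop_iff_nat 1]
  simp only [Nat.add_sub_cancel]
  rw [tendsto_iff_norm_sub_tendsto_zero]
  have hr0 : (0 : ℝ) ≤ √2 / 2 := by positivity
  have hr : √2 / 2 < 1 := by
    have : √2 < 2 := by
      rw [Real.sqrt_lt' (by norm_num)]; norm_num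
    linarith
  have l1 : Tendsto (fun n : ℕ => ((n + 2 : ℕ) : ℝ) ^ 5 * (√2 / 2) ^ (n + 2)) atTop (nhds 0) :=
    (tendsto_add_atTop_iff_nat 2).2
      (tendsto_pow_const_mul_const_pow_of_abs_lt_one 5 (by rwa [abs_of_nonneg hr0]))
  have l2 : Tendsto (fun n : ℕ => (1 / 2 : ℝ) ^ n) atTop (nhds 0) :=
    tendsto_pow_atTop_nhds_zero_of_lt_one (by norm_num) (by norm_num)
  have l3 : Tendsto (fun n : ℕ => (1 / 2 : ℝ) ^ n +
      12 * (((n + 2 : ℕ) : ℝ) ^ 5 * (√2 / 2) ^ (n + 2))) atTop (nhds 0) := by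
    simpa using l2.add (l1.const_mul 12)
  refine squeeze_zero (fun _ => norm_nonneg _) (fun n => ?_) l3
  have hb := main_bound n
  have hs : (2 : ℝ) ^ ((n + 1) / 2) ≤ √2 ^ (n + 2) := by
    calc (2 : ℝ) ^ ((n + 1) / 2) = √2 ^ (2 * ((n + 1) / 2)) := by
          rw [pow_mul, Real.sq_sqrt (by norm_num)]
      _ ≤ _ := pow_le_pow_right₀ (Real.one_le_sqrt.2 (by norm_num)) (by omega)
  set E : ℝ := (polyCount (n + 1) : ℝ) - (2 ^ (n + 1) - 1) / (2 * (n + 1)) with hE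
  have hp : (polyCount (n + 1) : ℝ) = E + (2 ^ (n + 1) - 1) / (2 * (n + 1)) := by rw [hE]; ring
  have h2 : (0 : ℝ) < 2 ^ n := by positivity
  have hid : (polyCount (n + 1) : ℝ) * ((n + 1 : ℕ) : ℝ) / 2 ^ n - 1 =
      E * (n + 1) / 2 ^ n - (1 / 2) * (1 / 2) ^ n := by
    rw [hp, one_div_pow]
    push_cast
    field_simp
    ring
  rw [hid, Real.norm_eq_abs]
  have hE2 : |E * (n + 1) / 2 ^ n| ≤ 12 * (((n + 2 : ℕ) : ℝ) ^ 5 * (√2 / 2) ^ (n + 2)) := by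
    rw [abs_div, abs_mul, abs_of_pos h2, abs_of_nonneg (by positivity : (0 : ℝ) ≤ n + 1)]
    calc |E| * (n + 1) / 2 ^ n ≤ 3 * ((n + 2) ^ 4 * √2 ^ (n + 2)) * (n + 2) / 2 ^ n := by
          gcongr
          · exact hb.trans (by gcongr)
          · norm_num
      _ = _ := by
          rw [div_pow]
          push_cast
          rw [pow_add (2 : ℝ) n 2]
          field_simp
          ring
  have h3 : |(1 / 2 : ℝ) * (1 / 2) ^ n| ≤ (1 / 2) ^ n := by
    rw [abs_of_nonneg (by positivity)]
    have : (0 : ℝ) ≤ (1 / 2) ^ n := by positivity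
    linarith
  have := abs_sub (E * (n + 1) / 2 ^ n) ((1 / 2 : ℝ) * (1 / 2) ^ n)
  linarith
end

section
/- For every n, the number of inequivalent integer quadrilaterals of perimeter n equals (n³-3n²+20n)/96 if n≡0 (mod 4), (n³-7n+6)/96 if n≡1 (mod 4), (n³-3n²+20n-36)/96 if n≡2 (mod 4), and (n³-7n-6)/96 if n≡3 (mod 4). -/
/-- Integer quadrilaterals of perimeter `n`: 4-tuples of positive integers summing to
`n`, each entry strictly less than `n/2`, indexed cyclically by `ZMod 4`. -/
def IntQuad (n : ℕ) : Type :=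
  {f : ZMod 4 → ℕ // (∀ i, 0 < f i ∧ 2 * f i < n) ∧ ∑ i, f i = n}

/-- Two quadrilaterals are equivalent iff one is obtained from the other by a cyclic
rotation and/or reversal of the four entries. -/
def QuadRel (n : ℕ) (a b : IntQuad n) : Prop :=
  ∃ (c : ZMod 4) (ε : Bool), ∀ i, b.1 i = a.1 (if ε then c - i else c + i)

/-- The number of inequivalent integer quadrilaterals with perimeter `n`. -/
noncomputable def quadCount (n : ℕ) : ℕ := Nat.card (Quot (QuadRel n))


/-- The fibre of canonical representatives with smaller opposite-pair sum `s`. -/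
def quadFib (n s : ℕ) : Finset (ℕ × ℕ) :=
  (Finset.Icc 1 (s / 2) ×ˢ Finset.Icc (n / 2 - s + 1) ((n - s) / 2)).filter
    (fun p => 2 * s = n → p.1 ≤ p.2)

/-- Canonical representatives. -/
def quadCanon (n : ℕ) : Finset (Σ _ : ℕ, ℕ × ℕ) :=
  (Finset.range (n / 2 + 1)).sigma (quadFib n)

theorem mem_quadCanon (n s a b : ℕ) : (⟨s, a, b⟩ : Σ _ : ℕ, ℕ × ℕ) ∈ quadCanon n ↔
    2 * s ≤ n ∧ 1 ≤ a ∧ 2 * a ≤ s ∧ n < 2 * s + 2 * b ∧ 2 * b + s ≤ n ∧ (2 * s = n → a ≤ b) := by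
  simp only [quadCanon, quadFib, Finset.mem_sigma, Finset.mem_range, Finset.mem_filter,
    Finset.mem_product, Finset.mem_Icc]
  omega

/-- The invariant of four numbers. -/
def quadInv (w x y z : ℕ) : Σ _ : ℕ, ℕ × ℕ :=
  if w + y < x + z then ⟨w + y, min w y, min x z⟩
  else if x + z < w + y then ⟨x + z, min x z, min w y⟩
  else ⟨w + y, min (min w y) (min x z), max (min w y) (min x z)⟩

theorem quadInv_rot (w x y z : ℕ) : quadInv x y z w = quadInv w x y z := by
  unfold quadInv
  rw [min_comm y w, max_comm (min x z), min_comm (min x z), add_comm y w]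
  split_ifs <;> first | rfl | omega | (congr 1; omega)

theorem quadInv_refl (w x y z : ℕ) : quadInv w z y x = quadInv w x y z := by
  unfold quadInv
  rw [min_comm z x, add_comm z x]

theorem sum_zmod4 (f : ZMod 4 → ℕ) : ∑ i, f i = f 0 + f 1 + f 2 + f 3 :=
  Fin.sum_univ_four f

theorem forall_zmod4 (P : ZMod 4 → Prop) : (∀ i, P i) ↔ P 0 ∧ P 1 ∧ P 2 ∧ P 3 := by
  constructor
  · intro h
    exact ⟨h 0, h 1, h 2, h 3⟩
  · rintro ⟨h0, h1, h2, h3⟩ i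
    fin_cases i <;> assumption

theorem quadInv_rel (n : ℕ) (a b : IntQuad n) (h : QuadRel n a b) :
    quadInv (a.1 0) (a.1 1) (a.1 2) (a.1 3) = quadInv (b.1 0) (b.1 1) (b.1 2) (b.1 3) := by
  obtain ⟨c, e, h⟩ := h
  rw [h 0, h 1, h 2, h 3]
  have key : ∀ c : ZMod 4, ∀ e : Bool, ∀ f : ZMod 4 → ℕ, quadInv (f 0) (f 1) (f 2) (f 3) =
      quadInv (f (if e then c - 0 else c + 0)) (f (if e then c - 1 else c + 1))
        (f (if e then c - 2 else c + 2)) (f (if e then c - 3 else c + 3)) := by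
    intro c e f
    have r := quadInv_rot
    have s := quadInv_refl
    revert c
    rw [forall_zmod4]
    cases e
    · refine ⟨rfl, (r _ _ _ _).symm, ?_, (r _ _ _ _)⟩
      exact (r _ _ _ _).symm.trans (r _ _ _ _).symm
    · refine ⟨(s _ _ _ _).symm, ?_, ?_, ?_⟩
      · exact (s _ _ _ _).symm.trans (r _ _ _ _)
      · exact (s _ _ _ _).symm.trans ((r _ _ _ _).trans (r _ _ _ _))
      · exact (s _ _ _ _).symm.trans (r _ _ _ _).symm
  exact key c e a.1

/-- Quadrilateral from four sides. -/
def mkQuad (n w x y z : ℕ) (h : (0 < w ∧ 2 * w < n) ∧ (0 < x ∧ 2 * x < n) ∧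
    (0 < y ∧ 2 * y < n) ∧ (0 < z ∧ 2 * z < n)) (hs : w + x + y + z = n) : IntQuad n :=
  ⟨(![w, x, y, z] : Fin 4 → ℕ), by
    exact ⟨(forall_zmod4 _).2 h, (sum_zmod4 _).trans hs⟩⟩

/-- Quadrilateral of a canonical code. -/
def ofCanon (n : ℕ) (t : quadCanon n) : IntQuad n :=
  mkQuad n t.1.2.1 t.1.2.2 (t.1.1 - t.1.2.1) (n - t.1.1 - t.1.2.2)
    (by
      obtain ⟨⟨s, a, b⟩, ht⟩ := t
      rw [mem_quadCanon] at ht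
      simp only
      omega)
    (by
      obtain ⟨⟨s, a, b⟩, ht⟩ := t
      rw [mem_quadCanon] at ht
      simp only
      omega)

theorem inv_ofCanon (n : ℕ) (t : quadCanon n) : quadInv ((ofCanon n t).1 0) ((ofCanon n t).1 1)
    ((ofCanon n t).1 2) ((ofCanon n t).1 3) = t.1 := by
  obtain ⟨⟨s, a, b⟩, ht⟩ := t
  rw [mem_quadCanon] at ht
  change quadInv a b (s - a) (n - s - b) = ⟨s, a, b⟩
  unfold quadInv
  have e1 : a + (s - a) = s := by omega
  have e2 : b + (n - s - b) = n - s := by omega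
  have e3 : min a (s - a) = a := by omega
  have e4 : min b (n - s - b) = b := by omega
  rw [e1, e2, e3, e4]
  split_ifs
  · rfl
  · omega
  · have e5 : min a b = a := by omega
    have e6 : max a b = b := by omega
    rw [e5, e6]

theorem ofCanon_surj (n : ℕ) (f : IntQuad n) : ∃ t : quadCanon n, QuadRel n (ofCanon n t) f := by
  obtain ⟨f, h1, h2⟩ := f
  rw [forall_zmod4] at h1
  rw [sum_zmod4] at h2
  have main : ∀ s a b : ℕ, (∃ (c : ZMod 4) (e : Bool), 
      (2 * s ≤ n ∧ 1 ≤ a ∧ 2 * a ≤ s ∧ n < 2 * s + 2 * b ∧ 2 * b + s ≤ n ∧ (2 * s = n → a ≤ b)) ∧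
      ∀ i, f i = (![a, b, s - a, n - s - b] : Fin 4 → ℕ) (if e then c - i else c + i : ZMod 4)) →
      ∃ t : quadCanon n, QuadRel n (ofCanon n t) ⟨f, by rw [forall_zmod4, sum_zmod4]; exact ⟨h1, h2⟩⟩ := by
    rintro s a b ⟨c, e, h, hh⟩
    exact ⟨⟨⟨s, a, b⟩, (mem_quadCanon n s a b).2 h⟩, c, e, hh⟩
  have fin : ∀ w x y z : ℕ, ∀ c : ZMod 4, ∀ e : Bool, (0 < w ∧ 0 < x ∧ 2 * y < n ∧ 2 * z < n) →
      w + x + y + z = n →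
      w ≤ y → x ≤ z → w + y ≤ x + z → (w + y = x + z → w ≤ x) →
      (∀ i, f i = (![w, x, y, z] : Fin 4 → ℕ) (if e then c - i else c + i : ZMod 4)) →
      ∃ t : quadCanon n, QuadRel n (ofCanon n t) ⟨f, by rw [forall_zmod4, sum_zmod4]; exact ⟨h1, h2⟩⟩ := by
    intro w x y z c e h hs h1 h2 h3 h4 h5
    refine main (w + y) w x ⟨c, e, by omega, ?_⟩
    have e1 : w + y - w = y := by omega
    have e2 : n - (w + y) - x = z := by omega
    rw [e1, e2]
    exact h5
  have ex : ∀ w x y z : ℕ, ∀ c : ZMod 4, ∀ e : Bool, 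
      f 0 = (![w, x, y, z] : Fin 4 → ℕ) (if e then c - 0 else c + 0 : ZMod 4) → 
      f 1 = (![w, x, y, z] : Fin 4 → ℕ) (if e then c - 1 else c + 1 : ZMod 4) → 
      f 2 = (![w, x, y, z] : Fin 4 → ℕ) (if e then c - 2 else c + 2 : ZMod 4) → 
      f 3 = (![w, x, y, z] : Fin 4 → ℕ) (if e then c - 3 else c + 3 : ZMod 4) → 
      (∀ i, f i = (![w, x, y, z] : Fin 4 → ℕ) (if e then c - i else c + i : ZMod 4)) := by
    intro w x y z c e a0 a1 a2 a3
    rw [forall_zmod4]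
    exact ⟨a0, a1, a2, a3⟩
  rcases le_total (f 0) (f 2) with h02 | h02 <;> rcases le_total (f 1) (f 3) with h13 | h13 <;>
  by_cases hl : f 0 + f 2 < f 1 + f 3 ∨ (f 0 + f 2 = f 1 + f 3 ∧ min (f 0) (f 2) ≤ min (f 1) (f 3))
  · exact fin (f 0) (f 1) (f 2) (f 3) 0 false (by omega) (by omega) (by omega) (by omega) (by omega) (by omega) (ex _ _ _ _ _ _ rfl rfl rfl rfl)
  · exact fin (f 1) (f 0) (f 3) (f 2) 1 true (by omega) (by omega) (by omega) (by omega) (by omega) (by omega) (ex _ _ _ _ _ _ rfl rfl rfl rfl)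
  · exact fin (f 0) (f 3) (f 2) (f 1) 0 true (by omega) (by omega) (by omega) (by omega) (by omega) (by omega) (ex _ _ _ _ _ _ rfl rfl rfl rfl)
  · exact fin (f 3) (f 0) (f 1) (f 2) 1 false (by omega) (by omega) (by omega) (by omega) (by omega) (by omega) (ex _ _ _ _ _ _ rfl rfl rfl rfl)
  · exact fin (f 2) (f 1) (f 0) (f 3) 2 true (by omega) (by omega) (by omega) (by omega) (by omega) (by omega) (ex _ _ _ _ _ _ rfl rfl rfl rfl)
  · exact fin (f 1) (f 2) (f 3) (f 0) 3 false (by omega) (by omega) (by omega) (by omega) (by omega) (by omega) (ex _ _ _ _ _ _ rfl rfl rfl rfl)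
  · exact fin (f 2) (f 3) (f 0) (f 1) 2 false (by omega) (by omega) (by omega) (by omega) (by omega) (by omega) (ex _ _ _ _ _ _ rfl rfl rfl rfl)
  · exact fin (f 3) (f 2) (f 1) (f 0) 3 true (by omega) (by omega) (by omega) (by omega) (by omega) (by omega) (ex _ _ _ _ _ _ rfl rfl rfl rfl)

theorem quadCount_eq_card (n : ℕ) : quadCount n = (quadCanon n).card := by
  unfold quadCount
  have hb : Function.Bijective
      (fun t : quadCanon n => (Quot.mk (QuadRel n) (ofCanon n t) : Quot (QuadRel n))) := by
    constructor
    · intro t u h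
      have := congrArg (Quot.lift (fun f : IntQuad n => quadInv (f.1 0) (f.1 1) (f.1 2) (f.1 3))
        (quadInv_rel n)) h
      simp only [inv_ofCanon] at this
      exact Subtype.ext this
    · intro q
      induction q using Quot.ind with
      | mk f =>
        obtain ⟨t, ht⟩ := ofCanon_surj n f
        exact ⟨t, Quot.sound ht⟩
  rw [← Nat.card_eq_of_bijective _ hb]
  simp

theorem card_fib_lt (n s : ℕ) (h : 2 * s ≠ n) :
    (quadFib n s).card = (s / 2) * ((n - s) / 2 - (n / 2 - s)) := by
  unfold quadFib
  rw [Finset.filter_true_of_mem (fun p _ h' => absurd h' h), Finset.card_product]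
  simp

theorem card_tri (p : ℕ) : (((Finset.Icc 1 p ×ˢ Finset.Icc 1 p).filter
    (fun q : ℕ × ℕ => q.1 ≤ q.2)).card : ℚ) = p * (p + 1) / 2 := by
  have : (Finset.Icc 1 p ×ˢ Finset.Icc 1 p).filter (fun q : ℕ × ℕ => q.1 ≤ q.2) =
      ((Finset.range (p + 1)).sigma (fun b => Finset.Icc 1 b)).map
        ⟨fun x => (x.2, x.1), by
          rintro ⟨a, b⟩ ⟨c, d⟩ h
          simp only [Prod.mk.injEq] at h
          obtain ⟨rfl, rfl⟩ := h
          rfl⟩ := by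
    ext ⟨a, b⟩
    simp only [Finset.mem_filter, Finset.mem_product, Finset.mem_Icc, Finset.mem_map,
      Finset.mem_sigma, Finset.mem_range, Function.Embedding.coeFn_mk, Prod.mk.injEq]
    constructor
    · intro h
      exact ⟨⟨b, a⟩, by simp only; omega, rfl⟩
    · rintro ⟨⟨c, d⟩, h, h1⟩
      obtain ⟨h2, h3⟩ := Prod.mk.inj h1
      simp only at h h2 h3
      omega
  rw [this, Finset.card_map, Finset.card_sigma]
  simp only [Nat.card_Icc, Nat.add_sub_cancel]
  clear this
  induction p with
  | zero => simp
  | succ p ih =>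
    rw [Finset.sum_range_succ, Nat.cast_add, ih]
    push_cast
    ring

theorem count_even (m : ℕ) : (quadCount (2 * m) : ℚ) =
    ∑ s ∈ Finset.range m, ((s / 2 : ℕ) : ℚ) ^ 2
      + ((m / 2 : ℕ) : ℚ) * (((m / 2 : ℕ) : ℚ) + 1) / 2 := by
  rw [quadCount_eq_card, quadCanon, Finset.card_sigma]
  have e : 2 * m / 2 = m := by omega
  rw [e, Finset.sum_range_succ, Nat.cast_add, ← card_tri]
  congr 1
  · rw [Nat.cast_sum]
    refine Finset.sum_congr rfl fun s hs => ?_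
    rw [Finset.mem_range] at hs
    rw [card_fib_lt _ _ (by omega)]
    have e2 : (2 * m - s) / 2 - (2 * m / 2 - s) = s / 2 := by omega
    rw [e2, Nat.cast_mul, sq]
  · have e3 : (2 * m - m) / 2 = m / 2 := by omega
    have e4 : 2 * m / 2 - m + 1 = 1 := by omega
    rw [quadFib, e3, e4]
    simp

theorem count_odd (m : ℕ) : (quadCount (2 * m + 1) : ℚ) =
    ∑ s ∈ Finset.range (m + 1), ((s / 2 : ℕ) : ℚ) * (((s + 1) / 2 : ℕ) : ℚ) := by
  rw [quadCount_eq_card, quadCanon, Finset.card_sigma]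
  have e : (2 * m + 1) / 2 = m := by omega
  rw [e, Nat.cast_sum]
  refine Finset.sum_congr rfl fun s hs => ?_
  rw [Finset.mem_range] at hs
  rw [card_fib_lt _ _ (by omega)]
  have e2 : (2 * m + 1 - s) / 2 - ((2 * m + 1) / 2 - s) = (s + 1) / 2 := by omega
  rw [e2, Nat.cast_mul]

theorem half_even (k : ℕ) : 2 * k / 2 = k := by omega
theorem half_odd (k : ℕ) : (2 * k + 1) / 2 = k := by omega
theorem half_even2 (k : ℕ) : (2 * k + 1 + 1) / 2 = k + 1 := by omega

theorem sum_sq_half (k : ℕ) : ∑ s ∈ Finset.range (2 * k), ((s / 2 : ℕ) : ℚ) ^ 2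
    = k * (k - 1) * (2 * k - 1) / 3 := by
  induction k with
  | zero => simp
  | succ k ih =>
    rw [show 2 * (k + 1) = 2 * k + 1 + 1 by ring, Finset.sum_range_succ, Finset.sum_range_succ,
      ih, half_even, half_odd]
    push_cast
    ring

theorem sum_mul_half (k : ℕ) : ∑ s ∈ Finset.range (2 * k + 1),
    ((s / 2 : ℕ) : ℚ) * (((s + 1) / 2 : ℕ) : ℚ) = k * (k + 1) * (4 * k - 1) / 6 := by
  induction k with
  | zero => simp
  | succ k ih =>
    rw [show 2 * (k + 1) + 1 = 2 * k + 1 + 1 + 1 by ring, Finset.sum_range_succ,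
      Finset.sum_range_succ, ih, half_odd, half_even2,
      show (2 * k + 1 + 1 + 1) / 2 = k + 1 by omega]
    push_cast
    ring

/-- Exact piecewise formula for the number of inequivalent integer quadrilaterals of
perimeter `n`, according to `n` modulo 4. -/
theorem quadCount_formula (n : ℕ) :
    (quadCount n : ℚ)
      = if n % 4 = 0 then ((n : ℚ) ^ 3 - 3 * n ^ 2 + 20 * n) / 96
        else if n % 4 = 1 then ((n : ℚ) ^ 3 - 7 * n + 6) / 96
        else if n % 4 = 2 then ((n : ℚ) ^ 3 - 3 * n ^ 2 + 20 * n - 36) / 96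
        else ((n : ℚ) ^ 3 - 7 * n - 6) / 96 := by
  obtain ⟨k, hk⟩ : ∃ k, k = n / 4 := ⟨_, rfl⟩
  have hlt : n % 4 < 4 := Nat.mod_lt _ (by norm_num)
  have hn : n = 4 * k + n % 4 := by omega
  generalize n % 4 = r at hlt hn
  subst hn
  clear hk
  interval_cases r
  · rw [if_pos rfl, show 4 * k + 0 = 2 * (2 * k) by ring, count_even, sum_sq_half, half_even]
    push_cast
    ring
  · rw [if_neg (by norm_num), if_pos rfl, show 4 * k + 1 = 2 * (2 * k) + 1 by ring, count_odd,
      sum_mul_half]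
    push_cast
    ring
  · rw [if_neg (by norm_num), if_neg (by norm_num), if_pos rfl,
      show 4 * k + 2 = 2 * (2 * k + 1) by ring, count_even, Finset.sum_range_succ, sum_sq_half,
      half_odd, half_even]
    push_cast
    ring
  · rw [if_neg (by norm_num), if_neg (by norm_num), if_neg (by norm_num),
      show 4 * k + 3 = 2 * (2 * k + 1) + 1 by ring, count_odd, Finset.sum_range_succ, sum_mul_half,
      half_odd, half_even2]
    push_cast
    ring
end
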